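/- arXiv:1409.8649 — 3 statements merged into one kernel-verified Lean document; each statement's English description precedes it below -/
import Mathlib

section
/- Let f : ℝⁿ → ℝⁿ be continuously differentiable and let u : ℝ → ℝⁿ be a nonconstant T-periodic solution of u' = f(u) (T > 0) such that div f(u(t)) = trace(Df(u(t))) > 0 for all t. Then the periodic orbit Γ = { u(t) : t ∈ ℝ } is orbitally unstable: there exists ε > 0 such that for every δ > 0 there exist T' ≥ 0 and a solution w of w' = f(w) defined on [0, T'] with dist(w(0), Γ) < δ and dist(w(T'), Γ) ≥ ε. -/
open Filter Topology

/-- The Jacobian matrix of a vector field `f : ℝⁿ → ℝⁿ` at a point `x`: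
`(Df(x))ᵢⱼ = ∂fᵢ/∂xⱼ (x)`. -/
noncomputable def jacobian {n : ℕ}
    (f : EuclideanSpace ℝ (Fin n) → EuclideanSpace ℝ (Fin n))
    (x : EuclideanSpace ℝ (Fin n)) : Matrix (Fin n) (Fin n) ℝ :=
  Matrix.of fun i j => fderiv ℝ f x (EuclideanSpace.single j 1) i

open scoped Matrix.Norms.Elementwise in
/-- The derivative of the determinant at the identity is the trace. -/
theorem Matrix.hasFDerivAt_det_one {ι : Type*} [Fintype ι] [DecidableEq ι] :
    HasFDerivAt (Matrix.det : Matrix ι ι ℝ → ℝ)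
      (LinearMap.toContinuousLinearMap (Matrix.traceLinearMap ι ℝ ℝ)) 1 := by
  have hdiff : DifferentiableAt ℝ (Matrix.det : Matrix ι ι ℝ → ℝ) 1 := by
    have hentry (i j : ι) : Differentiable ℝ (fun A : Matrix ι ι ℝ => A i j) :=
      (LinearMap.toContinuousLinearMap (Matrix.entryLinearMap ℝ ℝ i j)).differentiable
    have : (Matrix.det : Matrix ι ι ℝ → ℝ) =
        fun A => ∑ σ : Equiv.Perm ι, ((Equiv.Perm.sign σ : ℤ) : ℝ) * ∏ i, A (σ i) i := by
      funext A
      exact Matrix.det_apply' A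
    rw [this]
    refine DifferentiableAt.fun_sum fun σ _ => DifferentiableAt.const_mul ?_ _
    exact (HasFDerivAt.finsetProd fun i _ => (hentry (σ i) i 1).hasFDerivAt).differentiableAt
  convert! hdiff.hasFDerivAt using 1
  ext A
  have hline : HasDerivAt (fun r : ℝ => (1 : Matrix ι ι ℝ) + r • A) A 0 := by
    convert! ((hasDerivAt_id (0 : ℝ)).smul_const A).const_add (1 : Matrix ι ι ℝ) using 1
    exact (one_smul ℝ A).symm
  have hcomp : HasDerivAt (fun r : ℝ => ((1 : Matrix ι ι ℝ) + r • A).det)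
      (fderiv ℝ Matrix.det (1 : Matrix ι ι ℝ) A) 0 := by
    refine HasFDerivAt.comp_hasDerivAt (0 : ℝ) (l := (Matrix.det : Matrix ι ι ℝ → ℝ)) ?_ hline
    rw [zero_smul, add_zero]
    exact hdiff.hasFDerivAt
  have hpoly : HasDerivAt (fun r : ℝ => ((1 : Matrix ι ι ℝ) + r • A).det) A.trace 0 := by
    have h := (Matrix.det (1 + (Polynomial.X : Polynomial ℝ) • A.map Polynomial.C)).hasDerivAt 0
    rw [Matrix.derivative_det_one_add_X_smul] at h
    refine h.congr_of_eventuallyEq (Eventually.of_forall fun r => ?_)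
    simp [_root_.eval_det, ← Matrix.smul_eq_mul_diagonal]
  simpa using hpoly.unique hcomp

/-- On a compact set of matrices with trace at least `d > c`, the first order expansion
`det (1 + h A) = 1 + h tr A + o(h)` gives `det (1 + h A) ≥ 1 + h c` uniformly for small `h`. -/
theorem IsCompact.eventually_one_add_mul_le_det {ι : Type*} [Fintype ι] [DecidableEq ι]
    {S : Set (Matrix ι ι ℝ)} (hS : IsCompact S) {c d : ℝ} (hcd : c < d)
    (hd : ∀ A ∈ S, d ≤ A.trace) :
    ∀ᶠ h : ℝ in 𝓝[>] 0, ∀ A ∈ S, 1 + h * c ≤ (1 + h • A).det := by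
  open scoped Matrix.Norms.Elementwise in
  obtain ⟨R, hRpos, hR⟩ := hS.isBounded.exists_pos_norm_le
  have hη : 0 < (d - c) / R := div_pos (sub_pos.2 hcd) hRpos
  have hexp := (hasFDerivAt_iff_isLittleO_nhds_zero.1
    (Matrix.hasFDerivAt_det_one (ι := ι))).bound hη
  obtain ⟨r, hr, hball⟩ := Metric.eventually_nhds_iff.1 hexp
  have hrR : 0 < r / R := div_pos hr hRpos
  filter_upwards [Ioo_mem_nhdsGT hrR] with h hh A hA
  have hhA : ‖h • A‖ ≤ h * R := by
    rw [norm_smul, Real.norm_of_nonneg hh.1.le]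
    exact mul_le_mul_of_nonneg_left (hR A hA) hh.1.le
  have hlt : dist (h • A) 0 < r := by
    rw [dist_zero_right]
    exact hhA.trans_lt ((lt_div_iff₀ hRpos).1 hh.2)
  have hb := hball hlt
  have hle : (d - c) / R * ‖h • A‖ ≤ h * (d - c) :=
    (mul_le_mul_of_nonneg_left hhA hη.le).trans_eq (by field_simp)
  have habs := (abs_le.1 ((Real.norm_eq_abs _).symm.trans_le (hb.trans hle))).1
  have htr : h * d ≤ h * A.trace := mul_le_mul_of_nonneg_left (hd A hA) hh.1.le
  change -(h * (d - c)) ≤ (1 + h • A).det - (1 : Matrix ι ι ℝ).det - (h • A).trace at habs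
  rw [Matrix.trace_smul, Matrix.det_one, smul_eq_mul] at habs
  linarith

/-- A bounded Lipschitz vector field has solutions on every interval `[0, t]`. -/
theorem LipschitzWith.exists_forall_mem_Icc_hasDerivAt {E : Type*} [NormedAddCommGroup E]
    [NormedSpace ℝ E] [CompleteSpace E] {g : E → E} {K L : NNReal} (hg : LipschitzWith K g)
    (hL : ∀ x, ‖g x‖ ≤ L) (x : E) {t : ℝ} (ht : 0 ≤ t) :
    ∃ w : ℝ → E, w 0 = x ∧ ∀ s ∈ Set.Icc (0 : ℝ) t, HasDerivAt w (g (w s)) s := by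
  have h0 : (0 : ℝ) ∈ Set.Icc (-(t + 1)) (t + 1) := ⟨by linarith, by linarith⟩
  have hPL : IsPicardLindelof (fun _ => g) ⟨0, h0⟩ x (L * (t + 1).toNNReal) 0 L K := by
    refine IsPicardLindelof.of_time_independent (fun y _ => hL y) hg.lipschitzOnWith ?_
    simp [Real.coe_toNNReal (t + 1) (by linarith)]
  obtain ⟨w, hw0, hw⟩ := hPL.exists_eq_forall_mem_Icc_hasDerivWithinAt₀
  refine ⟨w, hw0, fun s hs => (hw s ⟨?_, ?_⟩).hasDerivAt (Icc_mem_nhds ?_ ?_)⟩ <;>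
    linarith [hs.1, hs.2]

/-- One step of the explicit Euler scheme with step size `h` for the vector field `g`. -/
def eulerStep {E : Type*} [AddCommGroup E] [Module ℝ E] (g : E → E) (h : ℝ) (x : E) : E :=
  x + h • g x

/-- The Euler scheme converges to the solutions of a bounded Lipschitz vector field. -/
theorem norm_eulerStep_iterate_sub_le {E : Type*} [NormedAddCommGroup E] [NormedSpace ℝ E]
    {g : E → E} {K L : NNReal} (hg : LipschitzWith K g) (hL : ∀ x, ‖g x‖ ≤ L) {w : ℝ → E} {t : ℝ}
    (hw : ∀ s ∈ Set.Icc (0 : ℝ) t, HasDerivAt w (g (w s)) s) {h : ℝ} (hh : 0 ≤ h) (k : ℕ)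
    (hk : k * h ≤ t) :
    ‖(eulerStep g h)^[k] (w 0) - w (k * h)‖ ≤ ((1 + h * K) ^ k - 1) * (h * L) := by
  induction k with
  | zero => simp
  | succ k ih =>
    have hcast : ((k + 1 : ℕ) : ℝ) * h = k * h + h := by push_cast; ring
    rw [hcast] at hk ⊢
    have ih := ih (by linarith)
    set a : ℝ := k * h with ha
    have ha0 : 0 ≤ a := by positivity
    set y := (eulerStep g h)^[k] (w 0)
    have hwI (s : ℝ) (hs : s ∈ Set.Icc a (a + h)) : HasDerivAt w (g (w s)) s :=
      hw s ⟨ha0.trans hs.1, hs.2.trans hk⟩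
    have hspeed (s : ℝ) (hs : s ∈ Set.Icc a (a + h)) : ‖w s - w a‖ ≤ L * (s - a) :=
      norm_image_sub_le_of_norm_deriv_le_segment' (fun r hr => (hwI r hr).hasDerivWithinAt)
        (fun r _ => hL _) s hs
    have hlocal : ‖w (a + h) - w a - h • g (w a)‖ ≤ K * (L * h) * h := by
      have hder (s : ℝ) (hs : s ∈ Set.Icc a (a + h)) :
          HasDerivWithinAt (fun r => w r - (r - a) • g (w a)) (g (w s) - g (w a))
            (Set.Icc a (a + h)) s := by
        have h1 : HasDerivAt (fun r => (r - a) • g (w a)) (g (w a)) s := by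
          simpa using ((hasDerivAt_id s).sub_const a).smul_const (g (w a))
        exact ((hwI s hs).sub h1).hasDerivWithinAt
      have hbound (s : ℝ) (hs : s ∈ Set.Ico a (a + h)) :
          ‖g (w s) - g (w a)‖ ≤ K * (L * h) := by
        refine (hg.norm_sub_le _ _).trans (mul_le_mul_of_nonneg_left ?_ K.2)
        refine (hspeed s ⟨hs.1, hs.2.le⟩).trans (mul_le_mul_of_nonneg_left ?_ L.2)
        linarith [hs.2]
      have := norm_image_sub_le_of_norm_deriv_le_segment' hder hbound (a + h)
        ⟨by linarith, le_rfl⟩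
      simp only [add_sub_cancel_left, sub_self, zero_smul, sub_zero] at this
      rwa [sub_right_comm] at this
    rw [Function.iterate_succ_apply']
    have hsplit : eulerStep g h y - w (a + h) =
        (y - w a) + h • (g y - g (w a)) - (w (a + h) - w a - h • g (w a)) := by
      simp only [eulerStep, smul_sub]
      abel
    have hstep : ‖h • (g y - g (w a))‖ ≤ h * (K * ‖y - w a‖) := by
      rw [norm_smul, Real.norm_of_nonneg hh]
      exact mul_le_mul_of_nonneg_left (hg.norm_sub_le _ _) hh
    calc ‖eulerStep g h y - w (a + h)‖
        ≤ ‖y - w a‖ + h * (K * ‖y - w a‖) + K * (L * h) * h := by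
          rw [hsplit]
          refine (norm_sub_le _ _).trans ?_
          gcongr
          refine (norm_add_le _ _).trans ?_
          gcongr
      _ = (1 + h * K) * ‖y - w a‖ + K * (L * h) * h := by ring
      _ ≤ (1 + h * K) * (((1 + h * K) ^ k - 1) * (h * L)) + K * (L * h) * h := by gcongr
      _ = ((1 + h * K) ^ (k + 1) - 1) * (h * L) := by ring

theorem LipschitzWith.injective_eulerStep {E : Type*} [NormedAddCommGroup E] [NormedSpace ℝ E]
    {g : E → E} {K : NNReal} (hg : LipschitzWith K g) {h : ℝ} (hh : 0 ≤ h) (hK : h * K < 1) :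
    Function.Injective (eulerStep g h) := by
  intro x y hxy
  have hd : x - y = h • (g y - g x) := by
    simp only [eulerStep] at hxy
    rw [smul_sub, sub_eq_sub_iff_add_eq_add, hxy, add_comm]
  have hn : ‖x - y‖ ≤ h * K * ‖x - y‖ := by
    calc ‖x - y‖ = h * ‖g y - g x‖ := by
          conv_lhs => rw [hd, norm_smul, Real.norm_of_nonneg hh]
      _ ≤ h * (K * ‖y - x‖) := mul_le_mul_of_nonneg_left (hg.norm_sub_le _ _) hh
      _ = h * K * ‖x - y‖ := by rw [norm_sub_rev]; ring
  by_contra hne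
  have hpos : 0 < ‖x - y‖ := norm_pos_iff.2 (sub_ne_zero.2 hne)
  nlinarith

open MeasureTheory in
/-- If an injective map expands volume by a factor at least `m` on `S`, and the first `N` iterates
of `A` lie in `S`, then the `N`-th iterate of `A` has volume at least `m ^ N` times that of `A`. -/
theorem MeasureTheory.Measure.pow_mul_le_addHaar_image_iterate {E : Type*} [NormedAddCommGroup E]
    [NormedSpace ℝ E] [FiniteDimensional ℝ E] [MeasurableSpace E] [BorelSpace E] (μ : Measure E)
    [μ.IsAddHaarMeasure] {φ : E → E} {φ' : E → E →L[ℝ] E} (hφ : Continuous φ)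
    (hinj : Function.Injective φ) {S A : Set E} (hA : MeasurableSet A)
    (hφ' : ∀ x ∈ S, HasFDerivAt φ (φ' x) x) {m : ℝ} (hm : ∀ x ∈ S, m ≤ (φ' x).det) (N : ℕ)
    (hAS : ∀ k < N, ∀ x ∈ A, φ^[k] x ∈ S) :
    ENNReal.ofReal m ^ N * μ A ≤ μ (φ^[N] '' A) := by
  induction N with
  | zero => simp
  | succ N ih =>
    have hmeas : MeasurableSet (φ^[N] '' A) :=
      hA.image_of_continuousOn_injOn (hφ.iterate N).continuousOn (hinj.iterate N).injOn
    have hsub : ∀ x ∈ φ^[N] '' A, x ∈ S := by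
      rintro _ ⟨x, hx, rfl⟩
      exact hAS N N.lt_succ_self x hx
    rw [Function.iterate_succ', Set.image_comp,
      ← lintegral_abs_det_fderiv_eq_addHaar_image μ hmeas
        (fun x hx => (hφ' x (hsub x hx)).hasFDerivWithinAt) hinj.injOn]
    calc ENNReal.ofReal m ^ (N + 1) * μ A
        = ENNReal.ofReal m * (ENNReal.ofReal m ^ N * μ A) := by ring
      _ ≤ ENNReal.ofReal m * μ (φ^[N] '' A) := by
          gcongr
          exact ih fun k hk => hAS k (hk.trans N.lt_succ_self)
      _ = ∫⁻ _ in φ^[N] '' A, ENNReal.ofReal m ∂μ := by simp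
      _ ≤ _ := setLIntegral_mono' hmeas fun x hx =>
          ENNReal.ofReal_le_ofReal ((hm x (hsub x hx)).trans (le_abs_self _))

theorem continuous_jacobian {n : ℕ} {f : EuclideanSpace ℝ (Fin n) → EuclideanSpace ℝ (Fin n)}
    (hf : ContDiff ℝ 1 f) : Continuous (jacobian f) := by
  have hfd : Continuous (fderiv ℝ f) := hf.continuous_fderiv one_ne_zero
  refine continuous_pi fun i => continuous_pi fun j => ?_
  have := hfd.clm_apply (continuous_const (y := EuclideanSpace.single j (1 : ℝ)))
  exact (EuclideanSpace.proj (𝕜 := ℝ) i).continuous.comp this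

theorem det_id_add_smul_fderiv {n : ℕ}
    (f : EuclideanSpace ℝ (Fin n) → EuclideanSpace ℝ (Fin n)) (x : EuclideanSpace ℝ (Fin n))
    (h : ℝ) :
    (ContinuousLinearMap.id ℝ (EuclideanSpace ℝ (Fin n)) + h • fderiv ℝ f x).det =
      (1 + h • jacobian f x).det := by
  let b := (EuclideanSpace.basisFun (Fin n) ℝ).toBasis
  rw [ContinuousLinearMap.det, ← LinearMap.det_toMatrix b]
  congr 1
  ext i j
  simp [b, LinearMap.toMatrix_apply, jacobian, Matrix.one_apply]

/-- A `C¹` vector field agrees near any bounded set with a bounded Lipschitz one. -/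
theorem ContDiff.exists_lipschitzWith_eventuallyEq {E : Type*} [NormedAddCommGroup E]
    [InnerProductSpace ℝ E] [FiniteDimensional ℝ E] {f : E → E} (hf : ContDiff ℝ 1 f) {S : Set E}
    (hS : Bornology.IsBounded S) :
    ∃ (g : E → E) (K L : NNReal), LipschitzWith K g ∧ (∀ x, ‖g x‖ ≤ L) ∧
      ∀ x ∈ S, g =ᶠ[𝓝 x] f := by
  obtain ⟨R, hRpos, hR⟩ := hS.exists_pos_norm_lt
  let χ : ContDiffBump (0 : E) := ⟨R, R + 1, hRpos, by linarith⟩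
  have hsupp : HasCompactSupport (fun x => χ x • f x) := χ.hasCompactSupport.smul_right
  have hdiff : ContDiff ℝ 1 (fun x => χ x • f x) := χ.contDiff.smul hf
  obtain ⟨K, hK⟩ := hdiff.lipschitzWith_of_hasCompactSupport hsupp one_ne_zero
  obtain ⟨L, hL⟩ := hdiff.continuous.bounded_above_of_compact_support hsupp
  refine ⟨_, K, L.toNNReal, hK, fun x => (hL x).trans (Real.le_coe_toNNReal L), fun x hx => ?_⟩
  have hx : x ∈ Metric.ball (0 : E) R := by simpa using hR x hx
  filter_upwards [χ.eventuallyEq_one_of_mem_ball hx] with y hy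
  simp [hy]

open MeasureTheory in
/-- Near a nonempty compact set on which a `C¹` vector field has positive divergence, volume
expansion forces some solution to leave a fixed neighbourhood. -/
theorem exists_escaping_solution_of_pos_div {n : ℕ}
    {f : EuclideanSpace ℝ (Fin n) → EuclideanSpace ℝ (Fin n)} (hf : ContDiff ℝ 1 f)
    {Γ : Set (EuclideanSpace ℝ (Fin n))} (hΓ : IsCompact Γ) (hne : Γ.Nonempty)
    (hdiv : ∀ x ∈ Γ, 0 < (jacobian f x).trace) :
    ∃ ε > (0 : ℝ), ∀ δ > (0 : ℝ), ∃ T' ≥ (0 : ℝ), ∃ w : ℝ → EuclideanSpace ℝ (Fin n),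
      (∀ t ∈ Set.Icc (0 : ℝ) T', HasDerivAt w (f (w t)) t) ∧
      Metric.infDist (w 0) Γ < δ ∧ ε ≤ Metric.infDist (w T') Γ := by
  have htr : Continuous fun x => (jacobian f x).trace := (continuous_jacobian hf).matrix_trace
  obtain ⟨r, hr, hrsub⟩ :=
    hΓ.exists_cthickening_subset_open (isOpen_lt continuous_const htr) hdiv
  set S := Metric.cthickening r Γ
  have hS : IsCompact S := hΓ.cthickening
  have hΓS : Γ ⊆ S := Metric.self_subset_cthickening Γ
  have hmemS {x} (hx : Metric.infDist x Γ < r) : x ∈ S :=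
    Metric.thickening_subset_cthickening r Γ ((Metric.mem_thickening_iff_infDist_lt hne).2 hx)
  obtain ⟨x₀, hx₀, hmin⟩ := hS.exists_isMinOn (hne.mono hΓS) htr.continuousOn
  set d := (jacobian f x₀).trace
  have hdpos : 0 < d := hrsub hx₀
  have hdet := (hS.image (continuous_jacobian hf)).eventually_one_add_mul_le_det
    (half_lt_self hdpos) (by
      rintro _ ⟨x, hx, rfl⟩
      exact hmin hx)
  obtain ⟨g, K, L, hgK, hgL, hgf⟩ := hf.exists_lipschitzWith_eventuallyEq hS.isBounded
  refine ⟨r / 2, half_pos hr, fun δ hδ => ?_⟩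
  by_contra! hstable
  set A := Metric.thickening δ Γ ∩ Metric.thickening (r / 2) Γ
  have hAopen : IsOpen A := Metric.isOpen_thickening.inter Metric.isOpen_thickening
  obtain ⟨p, hp⟩ := hne
  have hAne : A.Nonempty := ⟨p, Metric.self_subset_thickening hδ Γ hp,
    Metric.self_subset_thickening (half_pos hr) Γ hp⟩
  have hne : Γ.Nonempty := ⟨p, hp⟩
  have hstay (w : ℝ → EuclideanSpace ℝ (Fin n)) (hw0 : w 0 ∈ A) (t : ℝ)
      (hw : ∀ s ∈ Set.Icc (0 : ℝ) t, HasDerivAt w (g (w s)) s) :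
      ∀ s ∈ Set.Icc (0 : ℝ) t, Metric.infDist (w s) Γ < r / 2 := by
    by_contra! hex
    have hcont : ContinuousOn (fun s => Metric.infDist (w s) Γ) (Set.Icc 0 t) :=
      (Metric.continuous_infDist_pt Γ).comp_continuousOn
        fun s hs => (hw s hs).continuousAt.continuousWithinAt
    have hcomp : IsCompact (Set.Icc 0 t ∩ (fun s => Metric.infDist (w s) Γ) ⁻¹' Set.Ici (r / 2)) :=
      isCompact_Icc.of_isClosed_subset
        (hcont.preimage_isClosed_of_isClosed isClosed_Icc isClosed_Ici) Set.inter_subset_left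
    obtain ⟨τ, ⟨hτ, hτr⟩, hleast⟩ := hcomp.exists_isLeast hex
    have hbefore (s : ℝ) (hs : s ∈ Set.Ico 0 τ) : Metric.infDist (w s) Γ < r / 2 := by
      by_contra! hge
      exact (hleast ⟨⟨hs.1, hs.2.le.trans hτ.2⟩, hge⟩).not_gt hs.2
    have hτpos : 0 < τ := by
      refine hτ.1.lt_of_ne fun h0 => ?_
      rw [Set.mem_preimage, ← h0] at hτr
      exact hτr.not_gt ((Metric.mem_thickening_iff_infDist_lt hne).1 hw0.2)
    have hle (s : ℝ) (hs : s ∈ Set.Icc 0 τ) : Metric.infDist (w s) Γ ≤ r / 2 := by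
      have hclos : s ∈ closure (Set.Ico 0 τ) := by rwa [closure_Ico hτpos.ne]
      have hsub : Set.Icc 0 τ ⊆ Set.Icc 0 t := Set.Icc_subset_Icc_right hτ.2
      refine ((hcont.mono hsub) s hs).mono Set.Ico_subset_Icc_self |>.closure_le hclos
        continuousWithinAt_const fun y hy => (hbefore y hy).le
    refine (hstable τ hτpos.le w (fun s hs => ?_)
      ((Metric.mem_thickening_iff_infDist_lt hne).1 hw0.1)).not_ge hτr
    rw [← (hgf (w s) (hmemS ((hle s hs).trans_lt (half_lt_self hr)))).eq_of_nhds]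
    exact hw s ⟨hs.1, hs.2.trans hτ.2⟩
  have hμA : (volume A).toReal ≠ 0 := ENNReal.toReal_ne_zero.2
    ⟨(hAopen.measure_pos volume hAne).ne',
      ((hS.isBounded.subset fun x hx => hmemS (((Metric.mem_thickening_iff_infDist_lt hne).1
        hx.2).trans (half_lt_self hr))).measure_lt_top).ne⟩
  have hμApos : 0 < (volume A).toReal := lt_of_le_of_ne ENNReal.toReal_nonneg hμA.symm
  obtain ⟨t, htpos, ht⟩ : ∃ t > (0 : ℝ),
      (volume S).toReal < (1 + t * (d / 2)) * (volume A).toReal := by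
    refine ⟨2 / d * ((volume S).toReal / (volume A).toReal) + 1, by positivity, ?_⟩
    have : (1 + (2 / d * ((volume S).toReal / (volume A).toReal) + 1) * (d / 2)) *
        (volume A).toReal = (volume S).toReal + (1 + d / 2) * (volume A).toReal := by
      field_simp
      ring
    rw [this]
    linarith [mul_pos (by linarith : 0 < 1 + d / 2) hμApos]
  have hlim : Tendsto (fun N : ℕ => t / ((N : ℝ) + 1)) atTop (𝓝[>] 0) := by
    refine tendsto_nhdsWithin_iff.2 ⟨?_, Eventually.of_forall fun N => ?_⟩
    · simpa [div_eq_mul_inv] using (tendsto_one_div_add_atTop_nhds_zero_nat (𝕜 := ℝ)).const_mul t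
    · exact div_pos htpos (by positivity)
  have hsmall (a b : ℝ) (hb : 0 < b) : ∀ᶠ h : ℝ in 𝓝[>] 0, h * a < b := by
    refine nhdsWithin_le_nhds ?_
    have : Tendsto (fun h : ℝ => h * a) (𝓝 0) (𝓝 0) := by
      simpa using (continuous_mul_const a).tendsto 0
    exact this.eventually_lt_const hb
  obtain ⟨N, hdetN, hKN, hLN⟩ := (hlim.eventually (hdet.and ((hsmall K 1 one_pos).and
    (hsmall (L * Real.exp (t * K)) (r / 2) (half_pos hr))))).exists
  set h := t / ((N : ℝ) + 1) with hh
  have hpos : 0 < h := div_pos htpos (by positivity)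
  have hNh : ((N + 1 : ℕ) : ℝ) * h = t := by
    rw [hh]
    push_cast
    field_simp
  have hiter (k : ℕ) (hk : k ≤ N + 1) (x) (hx : x ∈ A) : (eulerStep g h)^[k] x ∈ S := by
    obtain ⟨w, rfl, hw⟩ := hgK.exists_forall_mem_Icc_hasDerivAt hgL x htpos.le
    have hkt : k * h ≤ t := by
      rw [← hNh]
      gcongr
    have hpow : (1 + h * K) ^ k ≤ Real.exp (t * K) := by
      calc (1 + h * K) ^ k ≤ Real.exp (h * K) ^ k := by
            gcongr
            linarith [Real.add_one_le_exp (h * K)]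
        _ = Real.exp (k * h * K) := by rw [← Real.exp_nat_mul]; ring_nf
        _ ≤ Real.exp (t * K) := by gcongr
    have herr : ‖(eulerStep g h)^[k] (w 0) - w (k * h)‖ < r / 2 := by
      refine (norm_eulerStep_iterate_sub_le hgK hgL hw hpos.le k hkt).trans_lt
        (lt_of_le_of_lt ?_ hLN)
      calc ((1 + h * K) ^ k - 1) * (h * L) ≤ Real.exp (t * K) * (h * L) := by
            gcongr
            linarith
        _ = h * (L * Real.exp (t * K)) := by ring
    have hwk := hstay w hx t hw (k * h) ⟨by positivity, hkt⟩
    refine hmemS ?_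
    have := Metric.infDist_le_infDist_add_dist (s := Γ) (x := (eulerStep g h)^[k] (w 0))
      (y := w (k * h))
    rw [dist_eq_norm] at this
    linarith
  have hderiv (x) (hx : x ∈ S) : HasFDerivAt (eulerStep g h)
      (ContinuousLinearMap.id ℝ _ + h • fderiv ℝ f x) x :=
    (hasFDerivAt_id x).add ((((hf.differentiable one_ne_zero) x).hasFDerivAt.congr_of_eventuallyEq
      (hgf x hx)).const_smul h)
  have hcont : Continuous (eulerStep g h) := by
    unfold eulerStep
    exact continuous_id.add (hgK.continuous.const_smul h)
  have hvol := volume.pow_mul_le_addHaar_image_iterate hcont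
    (hgK.injective_eulerStep hpos.le hKN) hAopen.measurableSet hderiv (m := 1 + h * (d / 2))
    (fun x hx => (hdetN _ ⟨x, hx, rfl⟩).trans_eq (det_id_add_smul_fderiv f x h).symm) (N + 1)
    (fun k hk x hx => hiter k hk.le x hx)
  have hvolS : ENNReal.ofReal (1 + h * (d / 2)) ^ (N + 1) * volume A ≤ volume S :=
    hvol.trans (measure_mono (Set.image_subset_iff.2 fun x hx => hiter (N + 1) le_rfl x hx))
  have hreal := ENNReal.toReal_mono hS.measure_lt_top.ne hvolS
  rw [ENNReal.toReal_mul, ENNReal.toReal_pow, ENNReal.toReal_ofReal (by positivity)] at hreal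
  have hbern : 1 + t * (d / 2) ≤ (1 + h * (d / 2)) ^ (N + 1) := by
    have hge : (-2 : ℝ) ≤ h * (d / 2) := by
      have : 0 < h * (d / 2) := by positivity
      linarith
    have := one_add_mul_le_pow hge (N + 1)
    rwa [← mul_assoc, hNh] at this
  exact absurd (hreal.trans_lt ht)
    (not_lt.2 (mul_le_mul_of_nonneg_right hbern ENNReal.toReal_nonneg))

/-- if `f` is `C¹` and `u` is a nonconstant `T`-periodic solution of `u' = f(u)`
with `div f(u(t)) = trace Df(u(t)) > 0` for all `t`, then the periodic orbit
`Γ = { u(t) : t ∈ ℝ }` is orbitally unstable. -/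
theorem periodic_orbit_unstable_of_pos_div {n : ℕ}
    (f : EuclideanSpace ℝ (Fin n) → EuclideanSpace ℝ (Fin n))
    (hf : ContDiff ℝ 1 f) (u : ℝ → EuclideanSpace ℝ (Fin n)) (T : ℝ) (hT : 0 < T)
    (hsol : ∀ t : ℝ, HasDerivAt u (f (u t)) t)
    (hper : ∀ t : ℝ, u (t + T) = u t)
    (hnc : ∃ t₁ t₂ : ℝ, u t₁ ≠ u t₂)
    (hdiv : ∀ t : ℝ, 0 < (jacobian f (u t)).trace) :
    ∃ ε > (0 : ℝ), ∀ δ > (0 : ℝ), ∃ T' ≥ (0 : ℝ),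
      ∃ w : ℝ → EuclideanSpace ℝ (Fin n),
        (∀ t ∈ Set.Icc (0 : ℝ) T', HasDerivAt w (f (w t)) t) ∧
        Metric.infDist (w 0) (Set.range u) < δ ∧
        ε ≤ Metric.infDist (w T') (Set.range u) := by
  have hu : Continuous u := continuous_iff_continuousAt.2 fun t => (hsol t).continuousAt
  have hΓ : IsCompact (Set.range u) := Function.Periodic.compact_of_continuous hper hT.ne' hu
  exact exists_escaping_solution_of_pos_div hf hΓ (Set.range_nonempty u)
    (Set.forall_mem_range.2 hdiv)
end

section
/- Let U ⊆ ℝⁿ be open, let f : U → ℝⁿ be continuously differentiable with div f(x) = trace(Df(x)) < 0 for all x ∈ U, and let K ⊆ U be a compact set that is invariant under the flow of f, i.e. there is a map φ : ℝ × ℝⁿ → ℝⁿ such that for every x ∈ K: φ(0, x) = x, t ↦ φ(t, x) takes values in K and satisfies ∂φ/∂t(t, x) = f(φ(t, x)) for all t ∈ ℝ, and φ(t, ·) maps K onto K for every t ∈ ℝ. Then the n-dimensional Lebesgue measure of K equals zero. -/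
open Filter Topology

open MeasureTheory Set Module

section

variable {E : Type*} [NormedAddCommGroup E] [NormedSpace ℝ E]

/-- A solution `w` of the approximately linear equation `w' ≈ A w` grows, after applying
the approximate inverse `1 - t A` of the linear flow, at most at a slow exponential rate. -/
theorem norm_sub_smul_le_of_deriv_approx {A : E →L[ℝ] E} {w w' : ℝ → E} {ε τ : ℝ}
    (hτ : 0 ≤ τ) (hA : τ * ‖A‖ ≤ 1 / 2) (hA2 : τ * ‖A‖ ^ 2 ≤ ε)
    (hw : ∀ s ∈ Icc 0 τ, HasDerivAt w (w' s) s)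
    (hw' : ∀ s ∈ Icc 0 τ, ‖w' s - A (w s)‖ ≤ ε * ‖w s‖) :
    ‖w τ - τ • A (w τ)‖ ≤ Real.exp (6 * ε * τ) * ‖w 0‖ := by
  have hε : 0 ≤ ε := le_trans (by positivity) hA2
  have hu : ∀ s ∈ Icc 0 τ, HasDerivAt (fun s => w s - s • A (w s))
      ((w' s - A (w s)) - s • A (w' s - A (w s)) - s • A (A (w s))) s := by
    intro s hs
    have h := (hw s hs).sub ((hasDerivAt_id s).smul ((A.hasFDerivAt).comp_hasDerivAt s (hw s hs)))
    refine h.congr_deriv ?_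
    simp only [id, one_smul, map_sub, smul_sub, Function.comp]
    abel
  have hbound : ∀ s ∈ Ico 0 τ,
      ‖(w' s - A (w s)) - s • A (w' s - A (w s)) - s • A (A (w s))‖ ≤
        6 * ε * ‖w s - s • A (w s)‖ + 0 := by
    intro s hs
    have hs' := Ico_subset_Icc_self hs
    have hsA : s * ‖A‖ ≤ 1 / 2 := le_trans (by gcongr; exact hs.2.le) hA
    have hsA2 : s * ‖A‖ ^ 2 ≤ ε := le_trans (by gcongr; exact hs.2.le) hA2
    have hnorm (v : E) : ‖s • A v‖ ≤ s * ‖A‖ * ‖v‖ := by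
      rw [norm_smul, Real.norm_of_nonneg hs.1, mul_assoc]
      exact mul_le_mul_of_nonneg_left (A.le_opNorm v) hs.1
    have h1 := norm_sub_le (w' s - A (w s) - s • A (w' s - A (w s))) (s • A (A (w s)))
    have h2 := norm_sub_le (w' s - A (w s)) (s • A (w' s - A (w s)))
    have h3 := (hnorm (w' s - A (w s))).trans
      (mul_le_mul_of_nonneg_right hsA (norm_nonneg _))
    have h4 : ‖s • A (A (w s))‖ ≤ ε * ‖w s‖ := by
      refine (hnorm _).trans ?_
      calc s * ‖A‖ * ‖A (w s)‖ ≤ s * ‖A‖ * (‖A‖ * ‖w s‖) :=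
            mul_le_mul_of_nonneg_left (A.le_opNorm _) (mul_nonneg hs.1 (norm_nonneg _))
        _ = s * ‖A‖ ^ 2 * ‖w s‖ := by ring
        _ ≤ _ := by gcongr
    have h5 : ‖w s‖ ≤ 2 * ‖w s - s • A (w s)‖ := by
      have h6 := norm_le_norm_sub_add (w s) (s • A (w s))
      have h7 := (hnorm (w s)).trans (mul_le_mul_of_nonneg_right hsA (norm_nonneg _))
      linarith
    have h8 := hw' s hs'
    have h9 := mul_le_mul_of_nonneg_left h5 hε
    have h10 := mul_nonneg hε (norm_nonneg (w s))
    linarith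
  have h := norm_le_gronwallBound_of_norm_deriv_right_le (δ := ‖w 0‖)
    (fun s hs => (hu s hs).continuousAt.continuousWithinAt)
    (fun s hs => (hu s (Ico_subset_Icc_self hs)).hasDerivWithinAt) (by simp) hbound
    τ (right_mem_Icc.2 hτ)
  rwa [gronwallBound_ε0, sub_zero, mul_comm] at h

variable [FiniteDimensional ℝ E]

/-- A `C`-Lipschitz map multiplies Haar measure by at most `C ^ finrank ℝ E`. -/
theorem LipschitzOnWith.addHaar_image_le [MeasurableSpace E] [BorelSpace E]
    (μ : Measure E) [μ.IsAddHaarMeasure] {C : NNReal} {g : E → E} {s : Set E}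
    (hg : LipschitzOnWith C g s) :
    μ (g '' s) ≤ (C : ENNReal) ^ finrank ℝ E * μ s := by
  rw [Measure.isAddLeftInvariant_eq_smul μ (Measure.hausdorffMeasure (finrank ℝ E : ℝ))]
  have h := hg.hausdorffMeasure_image_le (d := finrank ℝ E) (Nat.cast_nonneg _)
  rw [ENNReal.rpow_natCast] at h
  simp only [Measure.smul_apply, ENNReal.smul_def, smul_eq_mul]
  calc _ ≤ _ := mul_le_mul_right h _
    _ = _ := mul_left_comm _ _ _

theorem LinearMap.hasDerivAt_det_one_sub_smul (A : E →ₗ[ℝ] E) :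
    HasDerivAt (fun t : ℝ => LinearMap.det (1 - t • A)) (-LinearMap.trace ℝ E A) 0 := by
  set M := LinearMap.toMatrix (finBasis ℝ E) (finBasis ℝ E) A with hM
  set p := (Matrix.det (1 + (Polynomial.X : Polynomial ℝ) • M.map Polynomial.C)).divX.divX with
    hp_def
  have hdet (t : ℝ) : LinearMap.det (1 - t • A) =
      1 + M.trace * -t + p.eval (-t) * (-t) ^ 2 := by
    rw [hp_def, ← Matrix.det_one_add_smul, ← LinearMap.det_toMatrix (finBasis ℝ E), hM, map_sub,
      map_smul, LinearMap.toMatrix_one, neg_smul, sub_eq_add_neg]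
  rw [funext hdet, LinearMap.trace_eq_matrix_trace ℝ (finBasis ℝ E) A]
  have hneg : HasDerivAt (fun t : ℝ => -t) (-1) 0 := hasDerivAt_neg 0
  have hp : HasDerivAt (fun t : ℝ => p.eval (-t)) (p.derivative.eval (-0) * -1) 0 :=
    (p.hasDerivAt (-0)).comp 0 hneg
  refine ((hneg.const_mul M.trace).const_add 1 |>.add (hp.mul (hneg.pow 2))).congr_deriv ?_
  simp [M]

/-- Near a point where the vector field has negative divergence, the flow contracts volume
for all small positive times. -/
theorem HasStrictFDerivAt.eventually_measure_flow_image_le [MeasurableSpace E] [BorelSpace E]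
    (μ : Measure E) [μ.IsAddHaarMeasure] {f : E → E} {A : E →L[ℝ] E} {x₀ : E}
    (hf : HasStrictFDerivAt f A x₀) (htr : LinearMap.trace ℝ E (A : E →ₗ[ℝ] E) < 0)
    {K : Set E} {F : ℝ} (hF : ∀ x ∈ K, ‖f x‖ ≤ F) {φ : ℝ → E → E}
    (hφ0 : ∀ x ∈ K, φ 0 x = x) (hφK : ∀ x ∈ K, ∀ t : ℝ, φ t x ∈ K)
    (hφd : ∀ x ∈ K, ∀ t : ℝ, HasDerivAt (fun s => φ s x) (f (φ t x)) t) :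
    ∃ r > 0, ∀ᶠ t in 𝓝[>] (0 : ℝ), ∃ q : ENNReal, q < 1 ∧
      ∀ T ⊆ Metric.ball x₀ r ∩ K, μ (φ t '' T) ≤ q * μ T := by
  set n := finrank ℝ E
  set c := -LinearMap.trace ℝ E (A : E →ₗ[ℝ] E) with hc
  have hc0 : 0 < c := by linarith
  obtain ⟨ε, hε, hεc⟩ : ∃ ε > 0, n * (6 * ε) < c := by
    refine ⟨c / (6 * n + 1), by positivity, ?_⟩
    rw [← mul_assoc, ← mul_div_assoc, div_lt_iff₀ (by positivity)]
    nlinarith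
  obtain ⟨V, hV, hfV⟩ := hf.approximates_deriv_on_nhds (c := ε.toNNReal)
    (.inr (Real.toNNReal_pos.2 hε))
  obtain ⟨R, hR, hRV⟩ := Metric.mem_nhds_iff.1 hV
  refine ⟨R / 2, by positivity, ?_⟩
  have hsmall (a b : ℝ) (hb : 0 < b) : ∀ᶠ t in 𝓝[>] (0 : ℝ), t * a < b := by
    have : Tendsto (fun t : ℝ => t * a) (𝓝[>] 0) (𝓝 (0 * a)) :=
      ((continuous_mul_const a).tendsto 0).mono_left nhdsWithin_le_nhds
    exact this.eventually_lt_const (by simpa using hb)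
  have hdet : ∀ᶠ t in 𝓝[>] (0 : ℝ),
      Real.exp (6 * ε * t) ^ n < LinearMap.det (1 - t • (A : E →ₗ[ℝ] E)) := by
    have hexp : HasDerivAt (fun t : ℝ => Real.exp (6 * ε * t) ^ n) (n * (6 * ε)) 0 := by
      refine ((((hasDerivAt_id (0 : ℝ)).const_mul (6 * ε)).exp).pow n).congr_deriv ?_
      simp
    have hslope := ((LinearMap.hasDerivAt_det_one_sub_smul
      (A : E →ₗ[ℝ] E)).sub hexp).tendsto_slope_zero_right
    filter_upwards [hslope.eventually_const_lt (sub_pos.2 hεc), self_mem_nhdsWithin] with t h ht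
    have h' := (pos_iff_pos_of_mul_pos h).1 (inv_pos.2 ht)
    simpa using h'
  filter_upwards [hdet, self_mem_nhdsWithin, hsmall ‖A‖ (1 / 2) (by norm_num),
    hsmall (‖A‖ ^ 2) ε hε, hsmall F (R / 2) (by positivity)] with t htdet ht htA htA2 htF
  have ht0 : 0 < t := ht
  set P : E →L[ℝ] E := 1 - t • A
  set d := LinearMap.det (1 - t • (A : E →ₗ[ℝ] E))
  set L := Real.exp (6 * ε * t)
  have hd : 0 < d := lt_trans (by positivity) htdet
  refine ⟨ENNReal.ofReal (L ^ n / d), ?_, fun T hT => ?_⟩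
  · rw [← ENNReal.ofReal_one]
    exact (ENNReal.ofReal_lt_ofReal_iff one_pos).2 ((div_lt_one hd).2 htdet)
  have hmem : ∀ x ∈ T, ∀ s ∈ Icc 0 t, φ s x ∈ V := by
    intro x hx s hs
    have hxK := (hT hx).2
    have h := norm_image_sub_le_of_norm_deriv_le_segment' (a := 0) (b := t)
      (fun s _ => (hφd x hxK s).hasDerivWithinAt)
      (fun s _ => hF _ (hφK x hxK s)) s hs
    have hF0 : 0 ≤ F := (norm_nonneg _).trans (hF x hxK)
    have h1 : F * (s - 0) ≤ t * F := by nlinarith [hs.2]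
    have h2 : dist x x₀ < R / 2 := (hT hx).1
    rw [hφ0 x hxK, ← dist_eq_norm] at h
    refine hRV (Metric.mem_ball.2 ?_)
    linarith [dist_triangle (φ s x) x x₀]
  have hlip : LipschitzOnWith L.toNNReal (fun x => P (φ t x)) T := by
    refine LipschitzOnWith.of_dist_le_mul fun x hx y hy => ?_
    have h := norm_sub_smul_le_of_deriv_approx (A := A) (w := fun s => φ s x - φ s y) ht0.le
      htA.le htA2.le (fun s _ => (hφd x (hT hx).2 s).sub (hφd y (hT hy).2 s))
      (fun s hs => by
        simpa [hε.le] using hfV (φ s x) (hmem x hx s hs) (φ s y) (hmem y hy s hs))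
    rw [hφ0 x (hT hx).2, hφ0 y (hT hy).2] at h
    rw [dist_eq_norm, dist_eq_norm, ← map_sub, Real.coe_toNNReal _ (Real.exp_pos _).le]
    exact h
  have h := hlip.addHaar_image_le μ
  rw [← image_image P (φ t), Measure.addHaar_image_continuousLinearMap] at h
  have hPd : LinearMap.det (P : E →ₗ[ℝ] E) = d := rfl
  rw [hPd, _root_.abs_of_pos hd] at h
  rw [ENNReal.ofReal_div_of_pos hd, ENNReal.div_eq_inv_mul, mul_assoc,
    ← ENNReal.mul_le_iff_le_inv (by simpa using hd) ENNReal.ofReal_ne_top,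
    ENNReal.ofReal_pow (Real.exp_pos _).le]
  exact h

end

theorem trace_jacobian {n : ℕ} (f : EuclideanSpace ℝ (Fin n) → EuclideanSpace ℝ (Fin n))
    (x : EuclideanSpace ℝ (Fin n)) :
    (jacobian f x).trace =
      LinearMap.trace ℝ (EuclideanSpace ℝ (Fin n)) (fderiv ℝ f x : _ →ₗ[ℝ] _) := by
  rw [LinearMap.trace_eq_matrix_trace ℝ (EuclideanSpace.basisFun (Fin n) ℝ).toBasis]
  congr 1

/-- Liouville-type theorem: if `f` is `C¹` on an open set `U` with
`div f(x) = trace Df(x) < 0` on `U`, then any compact set `K ⊆ U` invariant under the flow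
of `f` has Lebesgue measure zero. -/
theorem volume_eq_zero_of_neg_div {n : ℕ}
    (U : Set (EuclideanSpace ℝ (Fin n))) (hU : IsOpen U)
    (f : EuclideanSpace ℝ (Fin n) → EuclideanSpace ℝ (Fin n))
    (hf : ContDiffOn ℝ 1 f U)
    (hdiv : ∀ x ∈ U, (jacobian f x).trace < 0)
    (K : Set (EuclideanSpace ℝ (Fin n))) (hK : IsCompact K) (hKU : K ⊆ U)
    (φ : ℝ → EuclideanSpace ℝ (Fin n) → EuclideanSpace ℝ (Fin n))
    (hφ0 : ∀ x ∈ K, φ 0 x = x)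
    (hφK : ∀ x ∈ K, ∀ t : ℝ, φ t x ∈ K)
    (hφd : ∀ x ∈ K, ∀ t : ℝ, HasDerivAt (fun s => φ s x) (f (φ t x)) t)
    (hφonto : ∀ t : ℝ, φ t '' K = K) :
    MeasureTheory.volume K = 0 := by
  have hF : ∃ F, ∀ x ∈ K, ‖f x‖ ≤ F :=
    hK.exists_bound_of_continuousOn (hf.continuousOn.mono hKU)
  obtain ⟨F, hF⟩ := hF
  obtain ⟨S, hKS, -, hS⟩ : ∃ S, K ⊆ S ∧ MeasurableSet S ∧
      ∀ᶠ t in 𝓝[>] (0 : ℝ), ∃ q : ENNReal, q < 1 ∧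
        ∀ T ⊆ S ∩ K, MeasurableSet T → volume (φ t '' T) ≤ q * volume T := by
    refine hK.induction_on (p := fun s => ∃ S, s ⊆ S ∧ MeasurableSet S ∧
      ∀ᶠ t in 𝓝[>] (0 : ℝ), ∃ q : ENNReal, q < 1 ∧
        ∀ T ⊆ S ∩ K, MeasurableSet T → volume (φ t '' T) ≤ q * volume T) ?_ ?_ ?_ ?_
    · refine ⟨∅, subset_rfl, .empty, .of_forall fun t => ⟨0, one_pos, fun T hT _ => ?_⟩⟩
      have : T = ∅ := by simpa using hT
      simp [this]
    · rintro s s' hss ⟨S, hs, hS⟩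
      exact ⟨S, hss.trans hs, hS⟩
    · rintro s₁ s₂ ⟨S₁, hs₁, hm₁, h₁⟩ ⟨S₂, hs₂, hm₂, h₂⟩
      refine ⟨S₁ ∪ S₂, union_subset_union hs₁ hs₂, hm₁.union hm₂, ?_⟩
      filter_upwards [h₁, h₂] with t ⟨q₁, hq₁, h₁⟩ ⟨q₂, hq₂, h₂⟩
      refine ⟨max q₁ q₂, max_lt hq₁ hq₂, fun T hT hTm => ?_⟩
      have hT₁ := h₁ (T ∩ S₁) (fun x hx => ⟨hx.2, (hT hx.1).2⟩) (hTm.inter hm₁)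
      have hT₂ := h₂ (T \ S₁) (fun x hx => ⟨(hT hx.1).1.resolve_left hx.2, (hT hx.1).2⟩)
        (hTm.diff hm₁)
      calc volume (φ t '' T) = volume (φ t '' (T ∩ S₁) ∪ φ t '' (T \ S₁)) := by
            rw [← image_union, inter_union_sdiff]
        _ ≤ volume (φ t '' (T ∩ S₁)) + volume (φ t '' (T \ S₁)) := measure_union_le _ _
        _ ≤ max q₁ q₂ * volume (T ∩ S₁) + max q₁ q₂ * volume (T \ S₁) :=
            add_le_add (hT₁.trans (by gcongr; exact le_max_left _ _))
              (hT₂.trans (by gcongr; exact le_max_right _ _))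
        _ = max q₁ q₂ * volume T := by rw [← mul_add, measure_inter_add_sdiff T hm₁]
    · intro x hx
      have hfx : HasStrictFDerivAt f (fderiv ℝ f x) x :=
        (hf.contDiffAt (hU.mem_nhds (hKU hx))).hasStrictFDerivAt one_ne_zero
      obtain ⟨r, hr, h⟩ := hfx.eventually_measure_flow_image_le volume
        (trace_jacobian f x ▸ hdiv x (hKU hx)) hF hφ0 hφK hφd
      refine ⟨Metric.ball x r, mem_nhdsWithin_of_mem_nhds (Metric.ball_mem_nhds x hr), _,
        subset_rfl, Metric.isOpen_ball.measurableSet, ?_⟩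
      filter_upwards [h] with t ⟨q, hq, h⟩
      exact ⟨q, hq, fun T hT _ => h T hT⟩
  obtain ⟨t, q, hq, h⟩ := hS.exists
  have hle := h K (subset_inter hKS subset_rfl) hK.measurableSet
  rw [hφonto t] at hle
  by_contra h0
  exact absurd hle (not_le.2 (by
    simpa using (ENNReal.mul_lt_mul_iff_left h0 hK.measure_lt_top.ne).2 hq))
end

section
/- Let U ⊆ ℝⁿ be open, let f : U → ℝⁿ be continuously differentiable, and for x ∈ U let λ₁(x) ≥ λ₂(x) ≥ … ≥ λₙ(x) denote the eigenvalues (with multiplicity, in decreasing order) of the symmetric matrix Df(x) + Df(x)ᵀ. Let K ⊆ U be a compact set invariant under the flow of f (there is φ : ℝ × ℝⁿ → ℝⁿ with φ(0, x) = x and ∂φ/∂t(t, x) = f(φ(t, x)) for x ∈ K and all t ∈ ℝ, with φ(t, ·) mapping K onto K for every t). Suppose k ∈ {1, …, n−1} and s ∈ [0, 1] are such that λ₁(x) + ⋯ + λ_k(x) + s·λ_{k+1}(x) < 0 for all x ∈ U. Then the Hausdorff dimension of K satisfies dim_H K < k + s. -/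
open Filter Topology Matrix

open scoped InnerProductSpace

section FrameVolume

variable {E : Type*} [NormedAddCommGroup E] [InnerProductSpace ℝ E]

theorem Fin.sum_castLE_eq_sum_ite {n p : ℕ} (hp : p ≤ n) (g : Fin n → ℝ) :
    ∑ i : Fin p, g (Fin.castLE hp i) = ∑ i : Fin n, if i.val < p then g i else 0 := by
  refine Fintype.sum_of_injective (Fin.castLE hp) (Fin.castLE_injective hp) _ _ ?_ ?_
  · intro i hi
    rw [if_neg]
    intro h
    exact hi ⟨⟨i, h⟩, rfl⟩
  · intro i
    simp

/-- Every `p`-tuple of vectors lies in the span of an orthonormal `p`-tuple. -/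
theorem exists_orthonormal_eq_sum_smul [FiniteDimensional ℝ E] {p : ℕ}
    (hp : p ≤ Module.finrank ℝ E) (v : Fin p → E) :
    ∃ (w : Fin p → E) (R : Matrix (Fin p) (Fin p) ℝ),
      Orthonormal ℝ w ∧ ∀ i, v i = ∑ j, R i j • w j := by
  set n := Module.finrank ℝ E with hn
  let f : Fin n → E := fun j => if h : j.val < p then v ⟨j, h⟩ else 0
  let b := InnerProductSpace.gramSchmidtOrthonormalBasis (by simp [hn] :
    Module.finrank ℝ E = Fintype.card (Fin n)) f
  refine ⟨fun i => b (Fin.castLE hp i), fun i j => ⟪b (Fin.castLE hp j), v i⟫_ℝ,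
    b.orthonormal.comp _ (Fin.castLE_injective hp), fun i => ?_⟩
  have hfi : f (Fin.castLE hp i) = v i := by simp [f]
  conv_lhs => rw [← b.sum_repr' (v i)]
  symm
  refine Fintype.sum_of_injective (Fin.castLE hp) (Fin.castLE_injective hp) _ _ ?_ fun _ => rfl
  intro j hj
  rw [← hfi]
  have hij : Fin.castLE hp i < j := by
    by_contra h
    exact hj ⟨⟨j, lt_of_le_of_lt (Fin.le_def.1 (not_lt.1 h)) i.2⟩, rfl⟩
  rw [InnerProductSpace.gramSchmidtOrthonormalBasis_inv_triangular _ f hij, zero_smul]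

theorem gram_sum_smul {p : ℕ} (w : Fin p → E) (R : Matrix (Fin p) (Fin p) ℝ) :
    Matrix.gram ℝ (fun i => ∑ j, R i j • w j) = R * Matrix.gram ℝ w * Rᵀ := by
  ext i j
  simp only [Matrix.gram_apply, Matrix.mul_apply, Matrix.transpose_apply, sum_inner, inner_sum,
    inner_smul_left, inner_smul_right, Finset.mul_sum, Finset.sum_mul, conj_trivial]
  refine Finset.sum_congr rfl fun a _ => Finset.sum_congr rfl fun b _ => by ring

theorem Matrix.PosSemidef.det_le_exp_trace_sub {p : ℕ} {G : Matrix (Fin p) (Fin p) ℝ}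
    (hG : G.PosSemidef) : G.det ≤ Real.exp (G.trace - p) := by
  have hsum : G.trace - p = ∑ i, (hG.1.eigenvalues i - 1) := by
    rw [hG.1.trace_eq_sum_eigenvalues]
    simp
  rw [hG.1.det_eq_prod_eigenvalues, hsum, Real.exp_sum]
  refine Finset.prod_le_prod (fun i _ => hG.eigenvalues_nonneg i) fun i _ => ?_
  have := Real.add_one_le_exp (hG.1.eigenvalues i - 1)
  simpa using this

/-- A linear map whose energy on orthonormal `p`-frames exceeds `p` by at most `c` expands the
Gram determinant of `p`-frames by at most the factor `exp c`. -/
theorem det_gram_map_le [FiniteDimensional ℝ E] {p : ℕ} (hp : p ≤ Module.finrank ℝ E)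
    (B : E →L[ℝ] E) {c : ℝ}
    (hB : ∀ w : Fin p → E, Orthonormal ℝ w → ∑ i, ‖B (w i)‖ ^ 2 ≤ p + c) (v : Fin p → E) :
    (Matrix.gram ℝ fun i => B (v i)).det ≤ Real.exp c * (Matrix.gram ℝ v).det := by
  obtain ⟨w, R, hw, hv⟩ := exists_orthonormal_eq_sum_smul hp v
  have hv' : v = fun i => ∑ j, R i j • w j := funext hv
  have hBv : (fun i => B (v i)) = fun i => ∑ j, R i j • B (w j) := by
    funext i
    simp [hv i]
  have hone : Matrix.gram ℝ w = 1 := by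
    ext i j
    rw [Matrix.gram_apply, orthonormal_iff_ite.1 hw, Matrix.one_apply]
  have hdet : (Matrix.gram ℝ fun i => B (w i)).det ≤ Real.exp c := by
    refine (Matrix.posSemidef_gram ℝ _).det_le_exp_trace_sub.trans (Real.exp_le_exp.2 ?_)
    have := hB w hw
    simp only [Matrix.trace, Matrix.diag_apply, Matrix.gram_apply, real_inner_self_eq_norm_sq]
    linarith
  rw [hBv, hv', gram_sum_smul w R, gram_sum_smul (fun j => B (w j)) R, hone]
  simp only [Matrix.det_mul, Matrix.det_transpose, Matrix.det_one]
  nlinarith [mul_le_mul_of_nonneg_left hdet (mul_self_nonneg R.det)]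

theorem sum_mul_le_sum_castLE {n p : ℕ} (hp : p ≤ n) {lam c : Fin n → ℝ} (hlam : Antitone lam)
    (hc0 : ∀ i, 0 ≤ c i) (hc1 : ∀ i, c i ≤ 1) (hc : ∑ i, c i = p) :
    ∑ i, lam i * c i ≤ ∑ i : Fin p, lam (Fin.castLE hp i) := by
  obtain ⟨m, hm1, hm2⟩ : ∃ m, (∀ i : Fin n, i.val < p → m ≤ lam i) ∧
      ∀ i : Fin n, p ≤ i.val → lam i ≤ m := by
    rcases Nat.eq_zero_or_pos p with rfl | hpos
    · rcases Nat.eq_zero_or_pos n with rfl | hn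
      · exact ⟨0, fun i => i.elim0, fun i => i.elim0⟩
      · exact ⟨lam ⟨0, hn⟩, fun i hi => absurd hi (Nat.not_lt_zero _),
          fun i _ => hlam (Fin.le_def.2 (Nat.zero_le _))⟩
    · refine ⟨lam ⟨p - 1, by omega⟩, fun i hi => hlam (Fin.le_def.2 ?_),
        fun i hi => hlam (Fin.le_def.2 ?_)⟩
      · simp only; omega
      · simp only; omega
  have hcard : ∑ i : Fin n, (if i.val < p then (1 : ℝ) else 0) = p := by
    rw [← Fin.sum_castLE_eq_sum_ite hp fun _ => 1]
    simp
  rw [Fin.sum_castLE_eq_sum_ite]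
  have key : ∑ i : Fin n, (lam i - m) * (c i - if i.val < p then 1 else 0) ≤ 0 := by
    refine Finset.sum_nonpos fun i _ => ?_
    split_ifs with h
    · nlinarith [hm1 i h, hc1 i]
    · nlinarith [hm2 i (not_lt.1 h), hc0 i]
  have expand : ∑ i : Fin n, (lam i - m) * (c i - if i.val < p then 1 else 0) =
      ∑ i, lam i * c i - (∑ i : Fin n, if i.val < p then lam i else 0)
        - m * (∑ i, c i - ∑ i : Fin n, if i.val < p then (1 : ℝ) else 0) := by
    simp only [Finset.mul_sum, mul_sub, ← Finset.sum_sub_distrib]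
    refine Finset.sum_congr rfl fun i _ => ?_
    split_ifs <;> ring
  rw [hc, hcard] at expand
  linarith

/-- Ky Fan's inequality for the symmetric part of `A`. -/
theorem two_mul_sum_inner_le {n p : ℕ} (hp : p ≤ n) {A : E →L[ℝ] E}
    {lam : Fin n → ℝ} (hlam : Antitone lam) (u : OrthonormalBasis (Fin n) ℝ E)
    (hu : ∀ v, 2 * ⟪v, A v⟫_ℝ = ∑ i, lam i * ⟪u i, v⟫_ℝ ^ 2)
    {w : Fin p → E} (hw : Orthonormal ℝ w) :
    ∑ i, 2 * ⟪w i, A (w i)⟫_ℝ ≤ ∑ i : Fin p, lam (Fin.castLE hp i) := by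
  simp only [hu]
  rw [Finset.sum_comm]
  simp only [← Finset.mul_sum]
  refine sum_mul_le_sum_castLE hp hlam (fun i => Finset.sum_nonneg fun _ _ => sq_nonneg _)
    (fun i => ?_) ?_
  · have := hw.sum_inner_products_le (u i) (s := Finset.univ)
    simpa [real_inner_comm] using this
  · rw [Finset.sum_comm]
    have : ∀ j, ∑ i, ⟪u i, w j⟫_ℝ ^ 2 = 1 := fun j => by
      have := u.sum_sq_norm_inner_right (w j)
      simpa [hw.1 j] using this
    simp [this]

theorem sum_norm_sq_one_add_smul_le {p : ℕ} {A : E →L[ℝ] E} {h Λ L : ℝ} (hh : 0 ≤ h)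
    (hA : ‖A‖ ≤ L) {w : Fin p → E} (hw : Orthonormal ℝ w)
    (hΛ : ∑ i, 2 * ⟪w i, A (w i)⟫_ℝ ≤ Λ) :
    ∑ i, ‖(1 + h • A) (w i)‖ ^ 2 ≤ p + (h * Λ + h ^ 2 * (p * L ^ 2)) := by
  have hterm : ∀ i, ‖(1 + h • A) (w i)‖ ^ 2 ≤ 1 + h * (2 * ⟪w i, A (w i)⟫_ℝ) + h ^ 2 * L ^ 2 := by
    intro i
    have h1 : ‖A (w i)‖ ≤ L := by
      have := A.le_opNorm (w i)
      rw [hw.1 i, mul_one] at this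
      exact this.trans hA
    have h2 : ‖A (w i)‖ ^ 2 ≤ L ^ 2 := pow_le_pow_left₀ (norm_nonneg _) h1 2
    have : (1 + h • A) (w i) = w i + h • A (w i) := by simp
    rw [this, norm_add_sq_real, hw.1 i, inner_smul_right, norm_smul, Real.norm_eq_abs, mul_pow,
      sq_abs]
    nlinarith [mul_le_mul_of_nonneg_left h2 (sq_nonneg h)]
  refine (Finset.sum_le_sum fun i _ => hterm i).trans ?_
  rw [Finset.sum_add_distrib, Finset.sum_add_distrib, ← Finset.mul_sum]
  simp only [Finset.sum_const, Finset.card_univ, Fintype.card_fin, nsmul_eq_mul, mul_one]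
  nlinarith [mul_le_mul_of_nonneg_left hΛ hh]

open ContinuousLinearMap in
/-- Left singular vectors and singular values of `M`. -/
theorem exists_orthonormalBasis_singularValues [FiniteDimensional ℝ E] {n : ℕ}
    (hn : Module.finrank ℝ E = n)
    (M : E →L[ℝ] E) :
    ∃ (b : OrthonormalBasis (Fin n) ℝ E) (σ : Fin n → ℝ), Antitone σ ∧ (∀ i, 0 ≤ σ i) ∧
      (∀ i, σ i ≤ ‖M‖) ∧ (∀ i v, |⟪b i, M v⟫_ℝ| ≤ σ i * ‖v‖) ∧
      ∀ (p : ℕ) (hp : p ≤ n), ∏ i : Fin p, σ (Fin.castLE hp i) ^ 2 =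
        (Matrix.gram ℝ fun i : Fin p => adjoint M (b (Fin.castLE hp i))).det := by
  have hT : ((M ∘L adjoint M : E →L[ℝ] E) : E →ₗ[ℝ] E).IsSymmetric := by
    intro x y
    simp [← adjoint_inner_right M, adjoint_inner_left M]
  let b := hT.eigenvectorBasis hn
  let μ := hT.eigenvalues hn
  have hb : ∀ i, M (adjoint M (b i)) = μ i • b i := fun i => by
    have := hT.apply_eigenvectorBasis hn i
    exact this
  have hinner : ∀ i j, ⟪adjoint M (b i), adjoint M (b j)⟫_ℝ = if i = j then μ i else 0 := by
    intro i j
    rw [adjoint_inner_left, hb, inner_smul_right, orthonormal_iff_ite.1 b.orthonormal]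
    split_ifs with h
    · simp [h]
    · simp
  have hμ : ∀ i, μ i = ‖adjoint M (b i)‖ ^ 2 := fun i => by
    rw [← real_inner_self_eq_norm_sq, hinner, if_pos rfl]
  have hsqrt : ∀ i, √(μ i) = ‖adjoint M (b i)‖ := fun i => by
    rw [hμ, Real.sqrt_sq (norm_nonneg _)]
  refine ⟨b, fun i => √(μ i), fun i j hij => Real.sqrt_le_sqrt (hT.eigenvalues_antitone hn hij),
    fun i => Real.sqrt_nonneg _, fun i => ?_, fun i v => ?_, fun p hp => ?_⟩
  · simp only [hsqrt]
    refine ((adjoint M).le_opNorm _).trans ?_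
    rw [b.norm_eq_one, mul_one, LinearIsometryEquiv.norm_map]
  · simp only [← adjoint_inner_left, hsqrt]
    exact abs_real_inner_le_norm _ _
  · have : (Matrix.gram ℝ fun i : Fin p => adjoint M (b (Fin.castLE hp i))) =
        Matrix.diagonal fun i => μ (Fin.castLE hp i) := by
      ext i j
      rw [Matrix.gram_apply, hinner, Matrix.diagonal_apply]
      simp
    rw [this, Matrix.det_diagonal]
    refine Finset.prod_congr rfl fun i _ => Real.sq_sqrt ?_
    rw [hμ]
    positivity

/-- The composition `(1 + h A_{j-1}) ∘ ⋯ ∘ (1 + h A_0)` of Euler steps. -/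
noncomputable def eulerProduct (h : ℝ) (A : ℕ → E →L[ℝ] E) : ℕ → E →L[ℝ] E
  | 0 => ContinuousLinearMap.id ℝ E
  | j + 1 => (1 + h • A j) ∘L eulerProduct h A j

theorem norm_one_add_smul_le {A : E →L[ℝ] E} {h L : ℝ} (hh : 0 ≤ h) (hA : ‖A‖ ≤ L) :
    ‖1 + h • A‖ ≤ Real.exp (L * h) := by
  have h1 : ‖(1 : E →L[ℝ] E)‖ ≤ 1 := ContinuousLinearMap.norm_id_le
  have h2 : ‖h • A‖ ≤ L * h := by
    rw [norm_smul, Real.norm_eq_abs, abs_of_nonneg hh, mul_comm]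
    gcongr
  have h3 := Real.add_one_le_exp (L * h)
  have h4 := norm_add_le (1 : E →L[ℝ] E) (h • A)
  linarith

theorem norm_eulerProduct_le {A : ℕ → E →L[ℝ] E} {h L : ℝ} (hh : 0 ≤ h)
    (hA : ∀ j, ‖A j‖ ≤ L) (j : ℕ) : ‖eulerProduct h A j‖ ≤ Real.exp (L * (j * h)) := by
  induction j with
  | zero => simpa [eulerProduct] using ContinuousLinearMap.norm_id_le
  | succ j ih =>
    refine (ContinuousLinearMap.opNorm_comp_le _ _).trans ?_
    have : L * ((j + 1 : ℕ) * h) = L * h + L * (j * h) := by push_cast; ring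
    rw [this, Real.exp_add]
    exact mul_le_mul (norm_one_add_smul_le hh (hA j)) ih (norm_nonneg _) (Real.exp_pos _).le

open ContinuousLinearMap in
theorem det_gram_adjoint_eulerProduct_le [FiniteDimensional ℝ E] {p : ℕ}
    (hp : p ≤ Module.finrank ℝ E) {A : ℕ → E →L[ℝ] E} {h L : ℝ} (hh : 0 ≤ h)
    (hA : ∀ j, ‖A j‖ ≤ L) {Λ : ℕ → ℝ}
    (hΛ : ∀ j (w : Fin p → E), Orthonormal ℝ w → ∑ i, 2 * ⟪w i, A j (w i)⟫_ℝ ≤ Λ j)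
    (j : ℕ) (v : Fin p → E) :
    (Matrix.gram ℝ fun i => adjoint (eulerProduct h A j) (v i)).det ≤
      Real.exp (∑ i ∈ Finset.range j, (h * Λ i + h ^ 2 * (p * L ^ 2))) *
        (Matrix.gram ℝ v).det := by
  induction j generalizing v with
  | zero =>
    have : adjoint (eulerProduct h A 0) = ContinuousLinearMap.id ℝ E := by
      rw [eulerProduct]
      exact adjoint_id
    simp [this]
  | succ j ih =>
    have hadj : adjoint (eulerProduct h A (j + 1)) =
        adjoint (eulerProduct h A j) ∘L (1 + h • adjoint (A j)) := by
      rw [eulerProduct, adjoint_comp, map_add]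
      congr 2
      · exact adjoint_id
      · simp
    simp only [hadj, coe_comp, Function.comp_apply]
    refine (ih fun i => (1 + h • adjoint (A j)) (v i)).trans ?_
    rw [Finset.sum_range_succ, Real.exp_add, mul_assoc]
    refine mul_le_mul_of_nonneg_left ?_ (Real.exp_pos _).le
    refine det_gram_map_le hp _ (fun w hw => ?_) v
    refine sum_norm_sq_one_add_smul_le hh ?_ hw ?_
    · rw [LinearIsometryEquiv.norm_map]
      exact hA j
    · refine le_trans (le_of_eq ?_) (hΛ j w hw)
      refine Finset.sum_congr rfl fun i _ => ?_
      rw [adjoint_inner_right, real_inner_comm]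

theorem prod_mul_rpow_le_exp {k : ℕ} {σ : Fin k → ℝ} {τ s X Y : ℝ} (hτ : 0 ≤ τ) (hs0 : 0 ≤ s)
    (hs1 : s ≤ 1) (hX : ∏ i, σ i ^ 2 ≤ Real.exp X)
    (hY : (∏ i, σ i ^ 2) * τ ^ 2 ≤ Real.exp Y) :
    (∏ i, σ i) * τ ^ s ≤ Real.exp (((1 - s) * X + s * Y) / 2) := by
  have hP : 0 ≤ ∏ i, σ i ^ 2 := Finset.prod_nonneg fun i _ => sq_nonneg _
  have hsq : ((∏ i, σ i) * τ ^ s) ^ 2 ≤ Real.exp (((1 - s) * X + s * Y) / 2) ^ 2 := by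
    have h1 : ((∏ i, σ i) * τ ^ s) ^ 2 =
        (∏ i, σ i ^ 2) ^ (1 - s) * ((∏ i, σ i ^ 2) * τ ^ 2) ^ s := by
      rw [Real.mul_rpow hP (sq_nonneg _), ← mul_assoc, ← Real.rpow_add' hP (by simp), mul_pow,
        ← Finset.prod_pow]
      simp only [sub_add_cancel, Real.rpow_one]
      rw [← Real.rpow_natCast (τ ^ s), ← Real.rpow_mul hτ, ← Real.rpow_natCast τ,
        ← Real.rpow_mul hτ, mul_comm s]
    have h2 : Real.exp (((1 - s) * X + s * Y) / 2) ^ 2 =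
        Real.exp X ^ (1 - s) * Real.exp Y ^ s := by
      rw [← Real.exp_mul, ← Real.exp_mul, ← Real.exp_add, ← Real.exp_nat_mul]
      congr 1
      push_cast
      ring
    rw [h1, h2]
    have : 0 ≤ 1 - s := by linarith
    gcongr
  exact le_of_sq_le_sq hsq (Real.exp_pos _).le

/-- Singular value bounds for a composition of Euler steps whose generators have negative
`(k + s)`-dimensional trace. -/
theorem exists_singularValues_eulerProduct [FiniteDimensional ℝ E] {n k : ℕ}
    (hn : Module.finrank ℝ E = n) (hkn : k < n) {A : ℕ → E →L[ℝ] E} {h L s δ : ℝ} (hh : 0 ≤ h)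
    (hA : ∀ j, ‖A j‖ ≤ L) (hs0 : 0 ≤ s) (hs1 : s ≤ 1) (hL : h * (n * L ^ 2) ≤ δ / 2)
    {X Y : ℕ → ℝ}
    (hX : ∀ j (w : Fin k → E), Orthonormal ℝ w → ∑ i, 2 * ⟪w i, A j (w i)⟫_ℝ ≤ X j)
    (hY : ∀ j (w : Fin (k + 1) → E), Orthonormal ℝ w → ∑ i, 2 * ⟪w i, A j (w i)⟫_ℝ ≤ Y j)
    (hXY : ∀ j, (1 - s) * X j + s * Y j ≤ -δ) (N : ℕ) :
    ∃ (b : OrthonormalBasis (Fin n) ℝ E) (σ : Fin n → ℝ), Antitone σ ∧ (∀ i, 0 ≤ σ i) ∧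
      (∀ i, σ i ≤ Real.exp (L * (N * h))) ∧
      (∀ i v, |⟪b i, eulerProduct h A N v⟫_ℝ| ≤ σ i * ‖v‖) ∧
      (∏ i : Fin k, σ (Fin.castLE hkn.le i)) * σ ⟨k, hkn⟩ ^ s ≤
        Real.exp (-(δ * (N * h)) / 4) := by
  obtain ⟨b, σ, hσ, hσ0, hσM, hbσ, hvol⟩ :=
    exists_orthonormalBasis_singularValues hn (eulerProduct h A N)
  refine ⟨b, σ, hσ, hσ0, fun i => (hσM i).trans (norm_eulerProduct_le hh hA N), hbσ, ?_⟩
  have hgram : ∀ p (hp : p ≤ n), (Matrix.gram ℝ fun i : Fin p => b (Fin.castLE hp i)).det = 1 := by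
    intro p hp
    have : (Matrix.gram ℝ fun i : Fin p => b (Fin.castLE hp i)) = 1 := by
      ext i j
      rw [Matrix.gram_apply, orthonormal_iff_ite.1 b.orthonormal, Matrix.one_apply]
      simp
    rw [this, Matrix.det_one]
  have h1 := det_gram_adjoint_eulerProduct_le (hn ▸ hkn.le) hh hA hX N
    fun i => b (Fin.castLE hkn.le i)
  have h2 := det_gram_adjoint_eulerProduct_le (hn ▸ hkn) hh hA hY N
    fun i => b (Fin.castLE hkn i)
  rw [hgram, mul_one, ← hvol] at h1 h2
  rw [Fin.prod_univ_castSucc] at h2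
  refine (prod_mul_rpow_le_exp (hσ0 _) hs0 hs1 h1 h2).trans
    (Real.exp_le_exp.2 ?_)
  have hstep : ∀ j, (1 - s) * (h * X j + h ^ 2 * (k * L ^ 2)) +
      s * (h * Y j + h ^ 2 * ((k + 1 : ℕ) * L ^ 2)) ≤ -(δ * h) / 2 := by
    intro j
    have e1 := mul_le_mul_of_nonneg_left (hXY j) hh
    have hk : (k : ℝ) + s ≤ n := by
      have : ((k + 1 : ℕ) : ℝ) ≤ n := by exact_mod_cast hkn
      push_cast at this
      linarith
    have e2 := mul_le_mul_of_nonneg_right hk (by positivity : 0 ≤ h ^ 2 * L ^ 2)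
    have e3 := mul_le_mul_of_nonneg_left hL hh
    push_cast
    nlinarith
  have := Finset.sum_le_sum fun j (_ : j ∈ Finset.range N) => hstep j
  rw [Finset.sum_add_distrib, ← Finset.mul_sum, ← Finset.mul_sum, Finset.sum_const,
    Finset.card_range, nsmul_eq_mul] at this
  linarith

end FrameVolume

section Covering

open Metric MeasureTheory

variable {E : Type*}

theorem Int.card_Icc_floor_neg_floor_le {x : ℝ} (hx : 1 ≤ x) :
    ((Finset.Icc ⌊-x⌋ ⌊x⌋).card : ℝ) ≤ 4 * x := by
  rw [Int.card_Icc]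
  have h1 := Int.floor_le x
  have h2 := Int.lt_floor_add_one (-x)
  have h3 : (0 : ℤ) ≤ ⌊x⌋ + 1 - ⌊-x⌋ := by
    have : ⌊-x⌋ ≤ ⌊x⌋ := Int.floor_le_floor (by linarith)
    omega
  have h4 : (((⌊x⌋ + 1 - ⌊-x⌋).toNat : ℤ) : ℝ) = ((⌊x⌋ + 1 - ⌊-x⌋ : ℤ) : ℝ) := by
    rw [Int.toNat_of_nonneg h3]
  rw [← Int.cast_natCast, h4]
  push_cast
  linarith

/-- A subset of a box with antitone side lengths is covered by balls whose radius is comparable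
to the `k`-th side length, in number comparable to the volume ratio. -/
theorem exists_finset_cover_of_subset_box [NormedAddCommGroup E] [InnerProductSpace ℝ E]
    {n k : ℕ} (hkn : k < n) (b : OrthonormalBasis (Fin n) ℝ E) {a : Fin n → ℝ} (ha : Antitone a)
    (ha0 : ∀ i, 0 < a i) {S : Set E} {z₀ : E} {ε : ℝ} (hε : 0 < ε)
    (hS : ∀ z ∈ S, ∀ i, |⟪b i, z - z₀⟫_ℝ| ≤ a i * ε) :
    ∃ F : Finset E, ↑F ⊆ S ∧ S ⊆ ⋃ y ∈ F, closedBall y (2 * √n * a ⟨k, hkn⟩ * ε) ∧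
      (F.card : ℝ) ≤ ∏ i : Fin k, 4 * (a (Fin.castLE hkn.le i) / a ⟨k, hkn⟩) := by
  set α := a ⟨k, hkn⟩ with hα
  have hα0 : 0 < α := ha0 _
  have hαε : 0 < α * ε := mul_pos hα0 hε
  let cell : E → Fin k → ℤ := fun z i => ⌊⟪b (Fin.castLE hkn.le i), z - z₀⟫_ℝ / (α * ε)⌋
  let Q : Finset (Fin k → ℤ) := Fintype.piFinset fun i =>
    Finset.Icc ⌊-(a (Fin.castLE hkn.le i) / α)⌋ ⌊a (Fin.castLE hkn.le i) / α⌋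
  have hcell : cell '' S ⊆ Q := by
    rintro _ ⟨z, hz, rfl⟩
    simp only [Q, Finset.mem_coe, Fintype.mem_piFinset, Finset.mem_Icc]
    intro i
    have h := abs_le.1 (hS z hz (Fin.castLE hkn.le i))
    have e : a (Fin.castLE hkn.le i) / α = a (Fin.castLE hkn.le i) * ε / (α * ε) := by
      field_simp
    constructor
    · refine Int.floor_le_floor ?_
      rw [e, ← neg_div]
      gcongr
      exact h.1
    · refine Int.floor_le_floor ?_
      rw [e]
      gcongr
      exact h.2
  have hfin : (cell '' S).Finite := Q.finite_toSet.subset hcell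
  obtain ⟨S', hS'S, hbij⟩ := Set.exists_subset_bijOn S cell
  have hS'fin : S'.Finite := (hbij.finite_iff_finite).2 hfin
  refine ⟨hS'fin.toFinset, by simpa using hS'S, fun z hz => ?_, ?_⟩
  · obtain ⟨y, hy, hyz⟩ := hbij.surjOn ⟨z, hz, rfl⟩
    simp only [Set.mem_iUnion, Set.Finite.mem_toFinset]
    refine ⟨y, hy, ?_⟩
    rw [mem_closedBall, dist_eq_norm]
    have hcoord : ∀ i, ‖⟪b i, z - y⟫_ℝ‖ ≤ 2 * (α * ε) := by
      intro i
      have hzy : ⟪b i, z - y⟫_ℝ = ⟪b i, z - z₀⟫_ℝ - ⟪b i, y - z₀⟫_ℝ := by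
        rw [← inner_sub_right, sub_sub_sub_cancel_right]
      rw [hzy, Real.norm_eq_abs]
      by_cases hi : i.val < k
      · have := congrFun hyz ⟨i, hi⟩
        have := Int.abs_sub_lt_one_of_floor_eq_floor this
        simp only [Fin.castLE_mk, Fin.eta] at this
        rw [← sub_div, abs_div, abs_of_pos hαε, div_lt_one hαε, abs_sub_comm] at this
        linarith
      · have hai : a i ≤ α := ha (Fin.le_def.2 (not_lt.1 hi))
        have := mul_le_mul_of_nonneg_right hai hε.le
        have h1 := hS z hz i
        have h2 := hS y (hS'S hy) i
        have h3 := abs_sub (⟪b i, z - z₀⟫_ℝ) ⟪b i, y - z₀⟫_ℝ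
        linarith
    have hsq : ‖z - y‖ ^ 2 ≤ (2 * √n * α * ε) ^ 2 := by
      rw [← b.sum_sq_norm_inner_right]
      calc ∑ i, ‖⟪b i, z - y⟫_ℝ‖ ^ 2 ≤ ∑ _i : Fin n, (2 * (α * ε)) ^ 2 :=
            Finset.sum_le_sum fun i _ => pow_le_pow_left₀ (norm_nonneg _) (hcoord i) 2
        _ = n * (2 * (α * ε)) ^ 2 := by simp
        _ = √n ^ 2 * (2 * (α * ε)) ^ 2 := by rw [Real.sq_sqrt (Nat.cast_nonneg n)]
        _ = (2 * √n * α * ε) ^ 2 := by ring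
    exact le_of_sq_le_sq hsq (by positivity)
  · have hcard : hS'fin.toFinset.card ≤ Q.card := by
      rw [← Set.ncard_eq_toFinset_card _ hS'fin, hbij.injOn.ncard_image.symm, hbij.image_eq,
        ← Set.ncard_coe_finset]
      exact Set.ncard_le_ncard hcell Q.finite_toSet
    calc (hS'fin.toFinset.card : ℝ) ≤ Q.card := by exact_mod_cast hcard
      _ ≤ _ := by
        rw [Fintype.card_piFinset]
        push_cast
        refine Finset.prod_le_prod (fun _ _ => Nat.cast_nonneg _) fun i _ => ?_
        refine Int.card_Icc_floor_neg_floor_le ?_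
        rw [one_le_div hα0]
        exact ha (Fin.le_def.2 i.2.le)

theorem sum_biUnion_le_sum_sum {ι β : Type*} [DecidableEq β] (s : Finset ι) (t : ι → Finset β)
    (f : β → ℝ) (hf : ∀ i ∈ s, ∀ x ∈ t i, 0 ≤ f x) :
    ∑ x ∈ s.biUnion t, f x ≤ ∑ i ∈ s, ∑ x ∈ t i, f x := by
  classical
  induction s using Finset.induction_on with
  | empty => simp
  | insert a s ha ih =>
    rw [Finset.biUnion_insert, Finset.sum_insert ha]
    have h1 := Finset.sum_union_inter (s₁ := t a) (s₂ := s.biUnion t) (f := f)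
    have h2 : 0 ≤ ∑ x ∈ t a ∩ s.biUnion t, f x := Finset.sum_nonneg fun x hx =>
      hf a (Finset.mem_insert_self a s) x (Finset.mem_inter.1 hx).1
    have h3 := ih fun i hi => hf i (Finset.mem_insert_of_mem hi)
    linarith

theorem exists_finset_balls_of_contracting_covers [PseudoMetricSpace E] {K : Set E}
    (hK : IsCompact K) {g : E → E} (hg : K ⊆ g '' K) {d ε₀ : ℝ} (hd : 0 < d) (hε₀ : 0 < ε₀)
    (H : ∀ x ∈ K, ∀ r, 0 < r → r ≤ ε₀ → ∃ (F : Finset E) (r' : ℝ), ↑F ⊆ K ∧ 0 < r' ∧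
      g '' (K ∩ closedBall x r) ⊆ ⋃ y ∈ F, closedBall y r' ∧ F.card * r' ^ d ≤ r ^ d / 2) :
    ∃ C : ℝ, ∀ m : ℕ, ∃ F : Finset (E × ℝ), (∀ p ∈ F, p.1 ∈ K ∧ 0 < p.2 ∧ p.2 ≤ ε₀) ∧
      K ⊆ ⋃ p ∈ F, closedBall p.1 p.2 ∧ ∑ p ∈ F, p.2 ^ d ≤ C / 2 ^ m := by
  classical
  choose! G ρ hGK hρ hcov hcard using H
  obtain ⟨t, htK, htfin, htcov⟩ := hK.finite_cover_balls hε₀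
  let F₀ : Finset (E × ℝ) := htfin.toFinset.image fun x => (x, ε₀)
  refine ⟨∑ p ∈ F₀, p.2 ^ d, fun m => ?_⟩
  induction m with
  | zero =>
    refine ⟨F₀, ?_, ?_, by simp⟩
    · intro p hp
      obtain ⟨x, hx, rfl⟩ := Finset.mem_image.1 hp
      exact ⟨htK (htfin.mem_toFinset.1 hx), hε₀, le_rfl⟩
    · intro x hx
      obtain ⟨y, hy, hxy⟩ := Set.mem_iUnion₂.1 (htcov hx)
      exact Set.mem_iUnion₂.2 ⟨(y, ε₀), Finset.mem_image.2 ⟨y, htfin.mem_toFinset.2 hy, rfl⟩,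
        ball_subset_closedBall hxy⟩
  | succ m ih =>
    obtain ⟨F, hF, hFcov, hFsum⟩ := ih
    refine ⟨F.biUnion fun p => (G p.1 p.2).image fun y => (y, ρ p.1 p.2), ?_, ?_, ?_⟩
    · intro q hq
      obtain ⟨p, hp, hq⟩ := Finset.mem_biUnion.1 hq
      obtain ⟨y, hy, rfl⟩ := Finset.mem_image.1 hq
      obtain ⟨h1, h2, h3⟩ := hF p hp
      refine ⟨hGK _ h1 _ h2 h3 hy, hρ _ h1 _ h2 h3, ?_⟩
      have hpos := hρ _ h1 _ h2 h3
      have hc : (1 : ℝ) ≤ (G p.1 p.2).card := by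
        exact_mod_cast Finset.card_pos.2 ⟨y, hy⟩
      have hle : ρ p.1 p.2 ^ d ≤ p.2 ^ d := by
        have e1 := hcard _ h1 _ h2 h3
        have e2 := Real.rpow_pos_of_pos hpos d
        have e3 := Real.rpow_pos_of_pos h2 d
        nlinarith
      exact ((Real.rpow_le_rpow_iff hpos.le h2.le hd).1 hle).trans h3
    · intro x hx
      obtain ⟨z, hz, rfl⟩ := hg hx
      obtain ⟨p, hp, hzp⟩ := Set.mem_iUnion₂.1 (hFcov hz)
      obtain ⟨h1, h2, h3⟩ := hF p hp
      obtain ⟨y, hy, hzy⟩ := Set.mem_iUnion₂.1 (hcov _ h1 _ h2 h3 ⟨z, ⟨hz, hzp⟩, rfl⟩)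
      exact Set.mem_iUnion₂.2 ⟨(y, ρ p.1 p.2), Finset.mem_biUnion.2
        ⟨p, hp, Finset.mem_image.2 ⟨y, hy, rfl⟩⟩, hzy⟩
    · rw [pow_succ, ← div_div]
      refine le_trans ?_ (div_le_div_of_nonneg_right hFsum zero_le_two)
      rw [Finset.sum_div]
      refine (sum_biUnion_le_sum_sum F _ _ fun p hp q hq => ?_).trans
        (Finset.sum_le_sum fun p hp => ?_)
      · obtain ⟨y, hy, rfl⟩ := Finset.mem_image.1 hq
        obtain ⟨h1, h2, h3⟩ := hF p hp
        exact Real.rpow_nonneg (hρ _ h1 _ h2 h3).le d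
      · obtain ⟨h1, h2, h3⟩ := hF p hp
        rw [Finset.sum_image fun a _ b _ hab => congrArg Prod.fst hab]
        simpa using hcard _ h1 _ h2 h3

/-- If the images of small balls centred in `K` are covered by balls of half the total
`d`-dimensional size, then an invariant compact set `K` is `d`-null. -/
theorem hausdorffMeasure_eq_zero_of_contracting_covers [MetricSpace E] [MeasurableSpace E]
    [BorelSpace E] {K : Set E}
    (hK : IsCompact K) {g : E → E} (hg : K ⊆ g '' K) {d ε₀ : ℝ} (hd : 0 < d) (hε₀ : 0 < ε₀)
    (H : ∀ x ∈ K, ∀ r, 0 < r → r ≤ ε₀ → ∃ (F : Finset E) (r' : ℝ), ↑F ⊆ K ∧ 0 < r' ∧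
      g '' (K ∩ closedBall x r) ⊆ ⋃ y ∈ F, closedBall y r' ∧ F.card * r' ^ d ≤ r ^ d / 2) :
    μH[d] K = 0 := by
  obtain ⟨C, hC⟩ := exists_finset_balls_of_contracting_covers hK hg hd hε₀ H
  choose F hF hFcov hFsum using hC
  have hlim : Tendsto (fun m : ℕ => C / 2 ^ m) atTop (𝓝 0) := by
    simpa [div_eq_mul_inv] using
      (tendsto_pow_atTop_nhds_zero_of_lt_one (by norm_num) (by norm_num) :
        Tendsto (fun m : ℕ => (2⁻¹ : ℝ) ^ m) atTop (𝓝 0)).const_mul C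
  have hrad : ∀ m, ∀ p ∈ F m, p.2 ≤ (C / 2 ^ m) ^ d⁻¹ := by
    intro m p hp
    have hnn : ∀ q ∈ F m, 0 ≤ q.2 ^ d := fun q hq => Real.rpow_nonneg (hF m q hq).2.1.le d
    have h1 : p.2 ^ d ≤ C / 2 ^ m := (Finset.single_le_sum hnn hp).trans (hFsum m)
    exact (Real.le_rpow_inv_iff_of_pos (hF m p hp).2.1.le ((hnn p hp).trans h1) hd).2 h1
  have hdiam : ∀ m, ∀ p ∈ F m, ediam (closedBall p.1 p.2) ≤ ENNReal.ofReal (2 * p.2) := by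
    intro m p hp
    refine ediam_le fun x hx y hy => ?_
    rw [edist_dist]
    refine ENNReal.ofReal_le_ofReal ?_
    have := dist_triangle_right x y p.1
    rw [mem_closedBall] at hx hy
    linarith
  have hle := Measure.hausdorffMeasure_le_liminf_sum (ι := fun m => {p // p ∈ F m}) d K
    (l := atTop) (fun m => ENNReal.ofReal (2 * (C / 2 ^ m) ^ d⁻¹)) ?_
    (fun m p => closedBall p.1.1 p.1.2) ?_ ?_
  · refine le_antisymm (hle.trans ?_) bot_le
    have hlim' : Tendsto (fun m : ℕ => ENNReal.ofReal (2 ^ d * (C / 2 ^ m))) atTop (𝓝 0) := by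
      simpa using ENNReal.tendsto_ofReal (hlim.const_mul (2 ^ d))
    rw [← hlim'.liminf_eq]
    refine liminf_le_liminf (Eventually.of_forall fun m => ?_)
    refine le_trans ?_ (ENNReal.ofReal_le_ofReal
      (mul_le_mul_of_nonneg_left (hFsum m) (by positivity)))
    rw [Finset.mul_sum, ENNReal.ofReal_sum_of_nonneg fun p hp =>
      mul_nonneg (by positivity) (Real.rpow_nonneg (hF m p hp).2.1.le d),
      ← Finset.sum_coe_sort (F m)]
    refine Finset.sum_le_sum fun p _ => ?_
    have hp0 := (hF m p.1 p.2).2.1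
    rw [← Real.mul_rpow zero_le_two hp0.le, ← ENNReal.ofReal_rpow_of_nonneg (by positivity) hd.le]
    exact ENNReal.rpow_le_rpow (hdiam m p.1 p.2) hd.le
  · have h := (hlim.rpow_const (p := d⁻¹) (Or.inr (by positivity))).const_mul 2
    rw [Real.zero_rpow (inv_ne_zero hd.ne'), mul_zero] at h
    simpa using ENNReal.tendsto_ofReal h
  · refine Eventually.of_forall fun m p => (hdiam m p.1 p.2).trans (ENNReal.ofReal_le_ofReal ?_)
    exact mul_le_mul_of_nonneg_left (hrad m p.1 p.2) zero_le_two
  · refine Eventually.of_forall fun m x hx => ?_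
    obtain ⟨p, hp, hxp⟩ := Set.mem_iUnion₂.1 (hFcov m hx)
    exact Set.mem_iUnion.2 ⟨⟨p, hp⟩, hxp⟩

end Covering

section Linearization

open Metric NNReal

variable {E : Type*} [NormedAddCommGroup E]

theorem exists_uniform_linearization [NormedSpace ℝ E] {U K : Set E} (hU : IsOpen U) {f : E → E}
    (hf : ContDiffOn ℝ 1 f U) (hK : IsCompact K) (hKU : K ⊆ U) {θ : ℝ} (hθ : 0 < θ) :
    ∃ ρ > 0, ∀ x ∈ K, ∀ y z, dist y x < ρ → dist z x < ρ →
      ‖f y - f z - fderiv ℝ f x (y - z)‖ ≤ θ * ‖y - z‖ := by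
  have hloc : ∀ x₀ : K, ∃ r > 0, ∀ x ∈ ball x₀.1 r, ∀ y ∈ ball x₀.1 r, ∀ z ∈ ball x₀.1 r,
      ‖f y - f z - fderiv ℝ f x (y - z)‖ ≤ θ * ‖y - z‖ := by
    rintro ⟨x₀, hx₀⟩
    have hfx := hf.contDiffAt (hU.mem_nhds (hKU hx₀))
    have h1 := (hfx.hasStrictFDerivAt one_ne_zero).isLittleO.def (half_pos hθ)
    rw [nhds_prod_eq] at h1
    obtain ⟨V, hV, hV'⟩ := mem_prod_self_iff.1 h1
    have h2 : ∀ᶠ x in 𝓝 x₀, dist (fderiv ℝ f x) (fderiv ℝ f x₀) < θ / 2 :=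
      (hfx.continuousAt_fderiv one_ne_zero).eventually (ball_mem_nhds _ (half_pos hθ))
    obtain ⟨r, hr, hrV⟩ := Metric.mem_nhds_iff.1 (inter_mem hV h2)
    refine ⟨r, hr, fun x hx y hy z hz => ?_⟩
    have e1 : ‖f y - f z - fderiv ℝ f x₀ (y - z)‖ ≤ θ / 2 * ‖y - z‖ :=
      hV' (Set.mk_mem_prod (hrV hy).1 (hrV hz).1)
    have e2 : dist (fderiv ℝ f x) (fderiv ℝ f x₀) < θ / 2 := (hrV hx).2
    rw [dist_comm, dist_eq_norm] at e2
    have e3 : ‖(fderiv ℝ f x₀ - fderiv ℝ f x) (y - z)‖ ≤ θ / 2 * ‖y - z‖ :=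
      (ContinuousLinearMap.le_opNorm _ _).trans (by gcongr)
    have e4 : f y - f z - fderiv ℝ f x (y - z) =
        (f y - f z - fderiv ℝ f x₀ (y - z)) + (fderiv ℝ f x₀ - fderiv ℝ f x) (y - z) := by
      simp only [_root_.sub_apply]
      abel
    rw [e4]
    have := norm_add_le (f y - f z - fderiv ℝ f x₀ (y - z))
      ((fderiv ℝ f x₀ - fderiv ℝ f x) (y - z))
    linarith
  choose r hr hlin using hloc
  obtain ⟨ρ, hρ, hρ'⟩ := lebesgue_number_lemma_of_metric hK
    (c := fun x : K => ball x.1 (r x)) (fun _ => isOpen_ball)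
    fun x hx => Set.mem_iUnion.2 ⟨⟨x, hx⟩, mem_ball_self (hr _)⟩
  refine ⟨ρ, hρ, fun x hx y z hy hz => ?_⟩
  obtain ⟨i, hi⟩ := hρ' x hx
  exact hlin i x (hi (mem_ball_self hρ)) y (hi hy) z (hi hz)

theorem norm_sub_one_add_smul_le [NormedSpace ℝ E] {K : Set E} {f : E → E} {L : ℝ≥0}
    (hL : LipschitzOnWith L f K) {F : ℝ} (hF : ∀ x ∈ K, ‖f x‖ ≤ F) {x y : ℝ → E}
    (hx : ∀ t, HasDerivAt x (f (x t)) t) (hxK : ∀ t, x t ∈ K)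
    (hy : ∀ t, HasDerivAt y (f (y t)) t) (hyK : ∀ t, y t ∈ K)
    {A : E →L[ℝ] E} (hA : ‖A‖ ≤ L) {t h θ ρ W : ℝ} (hh : 0 ≤ h)
    (hlin : ∀ u v, dist u (x t) < ρ → dist v (x t) < ρ → ‖f u - f v - A (u - v)‖ ≤ θ * ‖u - v‖)
    (hθ : 0 ≤ θ) (hFh : F * h < ρ / 2) (hLh : L * (L * h) ≤ θ) (hWρ : W < ρ / 2)
    (hW : ∀ τ ∈ Set.Icc t (t + h), ‖y τ - x τ‖ ≤ W) :
    ‖y (t + h) - x (t + h) - (1 + h • A) (y t - x t)‖ ≤ 2 * θ * h * W := by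
  have hmem : t + h ∈ Set.Icc t (t + h) := ⟨by linarith, le_rfl⟩
  have hF0 : 0 ≤ F := (norm_nonneg _).trans (hF _ (hxK t))
  have hW0 : 0 ≤ W := (norm_nonneg _).trans (hW _ hmem)
  have hwd : ∀ τ, HasDerivAt (fun τ => y τ - x τ) (f (y τ) - f (x τ)) τ := fun τ =>
    (hy τ).sub (hx τ)
  have hx_move : ∀ τ ∈ Set.Icc t (t + h), dist (x τ) (x t) < ρ / 2 := by
    intro τ hτ
    have := norm_image_sub_le_of_norm_deriv_le_segment' (fun τ _ => (hx τ).hasDerivWithinAt)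
      (fun τ _ => hF _ (hxK τ)) τ hτ
    rw [dist_eq_norm]
    have h2 : F * (τ - t) ≤ F * h := by
      have := hτ.2
      gcongr
      linarith
    linarith
  have hw_move : ∀ τ ∈ Set.Icc t (t + h),
      ‖(y τ - x τ) - (y t - x t)‖ ≤ L * W * h := by
    intro τ hτ
    have h1 := norm_image_sub_le_of_norm_deriv_le_segment' (C := L * W)
      (fun τ _ => (hwd τ).hasDerivWithinAt) (fun τ hτ' => ?_) τ hτ
    · refine h1.trans ?_
      have := hτ.2
      gcongr
      linarith
    · refine (hL.norm_sub_le (hyK τ) (hxK τ)).trans ?_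
      have := hW τ (Set.Ico_subset_Icc_self hτ')
      gcongr
  have hψ := norm_image_sub_le_of_norm_deriv_le_segment' (C := 2 * θ * W) (a := t) (b := t + h)
    (f := fun τ => y τ - x τ - (τ - t) • A (y t - x t))
    (f' := fun τ => f (y τ) - f (x τ) - A (y t - x t)) (fun τ _ => ?_) (fun τ hτ => ?_) (t + h) hmem
  · have e : y (t + h) - x (t + h) - (1 + h • A) (y t - x t) =
        (y (t + h) - x (t + h) - (t + h - t) • A (y t - x t)) -
          (y t - x t - (t - t) • A (y t - x t)) := by
      have : (1 + h • A) (y t - x t) = (y t - x t) + h • A (y t - x t) := by simp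
      rw [this, add_sub_cancel_left, sub_self, zero_smul]
      abel
    rw [e]
    refine hψ.trans (le_of_eq ?_)
    ring
  · have := ((hasDerivAt_id τ).sub_const t).smul_const (A (y t - x t))
    simp only [one_smul] at this
    exact ((hwd τ).sub this).hasDerivWithinAt
  · have hτ' := Set.Ico_subset_Icc_self hτ
    have e : f (y τ) - f (x τ) - A (y t - x t) =
        (f (y τ) - f (x τ) - A (y τ - x τ)) + A ((y τ - x τ) - (y t - x t)) := by
      rw [map_sub A (y τ - x τ)]
      abel
    have h1 : ‖f (y τ) - f (x τ) - A (y τ - x τ)‖ ≤ θ * W := by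
      refine (hlin _ _ ?_ ?_).trans (mul_le_mul_of_nonneg_left (hW τ hτ') hθ)
      · have e1 := dist_triangle (y τ) (x τ) (x t)
        have e2 := hx_move τ hτ'
        have e3 := hW τ hτ'
        rw [← dist_eq_norm] at e3
        linarith
      · have := hx_move τ hτ'
        have := dist_nonneg (x := x τ) (y := x t)
        linarith
    have h2 : ‖A ((y τ - x τ) - (y t - x t))‖ ≤ θ * W := by
      refine (A.le_opNorm _).trans ?_
      calc ‖A‖ * ‖(y τ - x τ) - (y t - x t)‖ ≤ L * (L * W * h) := by
            have := hw_move τ hτ'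
            gcongr
        _ = L * (L * h) * W := by ring
        _ ≤ θ * W := by gcongr
    rw [e]
    refine (norm_add_le _ _).trans ?_
    linarith

/-- Differences of nearby trajectories are shadowed by the composition of Euler steps of the
linearized equation. -/
theorem norm_sub_eulerProduct_le [InnerProductSpace ℝ E] {K : Set E} {f : E → E} {L : ℝ≥0}
    (hL : LipschitzOnWith L f K) (hA : ∀ x ∈ K, ‖fderiv ℝ f x‖ ≤ L) {F : ℝ}
    (hF : ∀ x ∈ K, ‖f x‖ ≤ F) {x y : ℝ → E}
    (hx : ∀ t, HasDerivAt x (f (x t)) t) (hxK : ∀ t, x t ∈ K)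
    (hy : ∀ t, HasDerivAt y (f (y t)) t) (hyK : ∀ t, y t ∈ K) {T h θ ρ : ℝ} (hh : 0 ≤ h)
    (hlin : ∀ x ∈ K, ∀ u v, dist u x < ρ → dist v x < ρ →
      ‖f u - f v - fderiv ℝ f x (u - v)‖ ≤ θ * ‖u - v‖)
    (hθ : 0 ≤ θ) (hFh : F * h < ρ / 2) (hLh : L * (L * h) ≤ θ)
    (hρ : Real.exp (L * T) * ‖y 0 - x 0‖ < ρ / 2) {N : ℕ} (hN : N * h = T) :
    ‖y T - x T - eulerProduct h (fun j => fderiv ℝ f (x (j * h))) N (y 0 - x 0)‖ ≤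
      2 * θ * T * Real.exp (L * T) * Real.exp (L * T) * ‖y 0 - x 0‖ := by
  set W := Real.exp (L * T) * ‖y 0 - x 0‖ with hWdef
  have hW0 : 0 ≤ W := by positivity
  have hW : ∀ τ ∈ Set.Icc 0 T, ‖y τ - x τ‖ ≤ W := by
    intro τ hτ
    have hgr := dist_le_of_trajectories_ODE_of_mem (v := fun _ => f) (s := fun _ => K)
      (fun _ _ => hL) (fun t _ => (hy t).continuousAt.continuousWithinAt)
      (fun t _ => (hy t).hasDerivWithinAt) (fun t _ => hyK t)
      (fun t _ => (hx t).continuousAt.continuousWithinAt)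
      (fun t _ => (hx t).hasDerivWithinAt) (fun t _ => hxK t) le_rfl τ hτ
    rw [dist_eq_norm, dist_eq_norm, sub_zero] at hgr
    refine hgr.trans ?_
    rw [hWdef, mul_comm]
    have := hτ.2
    gcongr
  have key : ∀ j ≤ N, ‖y (j * h) - x (j * h) -
      eulerProduct h (fun j => fderiv ℝ f (x (j * h))) j (y 0 - x 0)‖ ≤
        j * (2 * θ * h * W) * Real.exp (L * (j * h)) := by
    intro j
    induction j with
    | zero => simp [eulerProduct]
    | succ j ih =>
      intro hj
      have ih := ih (Nat.le_of_succ_le hj)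
      set P := eulerProduct h (fun j => fderiv ℝ f (x (j * h))) j
      set A := fderiv ℝ f (x (j * h))
      have htime : ((j + 1 : ℕ) : ℝ) * h = j * h + h := by push_cast; ring
      have hjN : (j : ℝ) * h + h ≤ T := by
        rw [← hN, ← htime]
        have : ((j + 1 : ℕ) : ℝ) ≤ N := by exact_mod_cast hj
        gcongr
      have hstep := norm_sub_one_add_smul_le hL hF hx hxK hy hyK (hA _ (hxK (j * h))) hh
        (hlin _ (hxK (j * h))) hθ hFh hLh hρ fun τ hτ =>
          hW τ ⟨le_trans (by positivity) hτ.1, hτ.2.trans hjN⟩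
      have hsplit : y (j * h + h) - x (j * h + h) -
          eulerProduct h (fun j => fderiv ℝ f (x (j * h))) (j + 1) (y 0 - x 0) =
          (y (j * h + h) - x (j * h + h) - (1 + h • A) (y (j * h) - x (j * h))) +
            (1 + h • A) (y (j * h) - x (j * h) - P (y 0 - x 0)) := by
        rw [map_sub (1 + h • A) (y (j * h) - x (j * h))]
        simp only [eulerProduct, ContinuousLinearMap.comp_apply]
        abel
      rw [htime, hsplit]
      have h2 : ‖(1 + h • A) (y (j * h) - x (j * h) - P (y 0 - x 0))‖ ≤
          Real.exp (L * h) * (j * (2 * θ * h * W) * Real.exp (L * (j * h))) :=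
        ((1 + h • A).le_opNorm _).trans
          (mul_le_mul (norm_one_add_smul_le hh (hA _ (hxK _))) ih (norm_nonneg _)
            (Real.exp_pos _).le)
      have h3 : Real.exp (L * (j * h + h)) = Real.exp (L * h) * Real.exp (L * (j * h)) := by
        rw [← Real.exp_add]
        congr 1
        ring
      have h4 : 1 ≤ Real.exp (L * (j * h + h)) := Real.one_le_exp (by positivity)
      have h5 : 0 ≤ 2 * θ * h * W := by positivity
      refine (norm_add_le _ _).trans ((add_le_add hstep h2).trans ?_)
      push_cast
      rw [h3] at h4 ⊢
      nlinarith [mul_le_mul_of_nonneg_left h4 h5]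
  have := key N le_rfl
  rw [hN] at this
  refine this.trans (le_of_eq ?_)
  rw [hWdef, ← hN]
  ring

end Linearization

section HausdorffMeasure

open Metric NNReal MeasureTheory

theorem exists_pos_prod_add_mul_rpow_le {n k : ℕ} (hkn : k < n) {s Q ζ : ℝ} (hs : 0 < s)
    (hζ : 0 < ζ) :
    ∃ η > 0, ∀ σ : Fin n → ℝ, (∀ i, 0 ≤ σ i) → (∀ i, σ i ≤ Q) →
      (∏ i : Fin k, (σ (Fin.castLE hkn.le i) + η)) * (σ ⟨k, hkn⟩ + η) ^ s ≤
        (∏ i : Fin k, σ (Fin.castLE hkn.le i)) * σ ⟨k, hkn⟩ ^ s + ζ := by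
  let G : (Fin n → ℝ) → ℝ := fun σ => (∏ i : Fin k, σ (Fin.castLE hkn.le i)) * σ ⟨k, hkn⟩ ^ s
  have hG : Continuous G := by
    refine Continuous.mul (by fun_prop) ?_
    exact (continuous_apply _).rpow_const fun _ => Or.inr hs.le
  have hunif := (isCompact_Icc (a := (fun _ => 0 : Fin n → ℝ))
    (b := fun _ => Q + 1)).uniformContinuousOn_of_continuous hG.continuousOn
  obtain ⟨η, hη, hclose⟩ := Metric.uniformContinuousOn_iff_le.1 hunif ζ hζ
  refine ⟨min η 1, lt_min hη one_pos, fun σ hσ0 hσQ => ?_⟩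
  have hm0 : 0 ≤ min η 1 := (lt_min hη one_pos).le
  have h := hclose (fun i => σ i + min η 1) ⟨fun i => add_nonneg (hσ0 i) hm0,
    fun i => add_le_add (hσQ i) (min_le_right _ _)⟩ σ
    ⟨fun i => hσ0 i, fun i => (hσQ i).trans (by simp)⟩ ?_
  · have := (abs_le.1 (Real.dist_eq _ _ ▸ h)).2
    simp only [G] at this
    linarith
  · refine (dist_pi_le_iff hη.le).2 fun i => ?_
    rw [Real.dist_eq, add_sub_cancel_left, abs_of_nonneg hm0]
    exact min_le_left _ _

variable {E : Type*} [NormedAddCommGroup E]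

theorem exists_lipschitzOnWith_and_norm_fderiv_le [NormedSpace ℝ E] {U K : Set E}
    (hU : IsOpen U) {f : E → E} (hf : ContDiffOn ℝ 1 f U) (hK : IsCompact K) (hKU : K ⊆ U) :
    ∃ L : ℝ≥0, LipschitzOnWith L f K ∧ ∀ x ∈ K, ‖fderiv ℝ f x‖ ≤ L := by
  have hloc : LocallyLipschitzOn K f := fun x hx => by
    obtain ⟨C, t, ht, hC⟩ :=
      (hf.contDiffAt (hU.mem_nhds (hKU hx))).exists_lipschitzOnWith
    exact ⟨C, t, mem_nhdsWithin_of_mem_nhds ht, hC⟩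
  obtain ⟨C₁, hC₁⟩ := hloc.exists_lipschitzOnWith_of_compact hK
  obtain ⟨C₂, hC₂⟩ := hK.exists_bound_of_continuousOn
    ((hf.continuousOn_fderiv_of_isOpen hU le_rfl).mono hKU)
  refine ⟨C₁ + C₂.toNNReal, hC₁.weaken le_self_add, fun x hx => (hC₂ x hx).trans ?_⟩
  push_cast
  have := Real.le_coe_toNNReal C₂
  have := C₁.2
  simp only [NNReal.val_eq_coe] at this
  linarith

/-- The number of balls used to cover an image of a ball, times the `d`-th power of their
radius, is controlled by the `d`-dimensional singular value function. -/
theorem card_mul_rpow_le {n k : ℕ} (hkn : k < n) {a : Fin n → ℝ} (ha : ∀ i, 0 < a i)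
    {c s r M B : ℝ} (hc : 0 < c) (hr : 0 < r)
    (hM : M ≤ ∏ i : Fin k, 4 * (a (Fin.castLE hkn.le i) / a ⟨k, hkn⟩))
    (hB : (∏ i : Fin k, a (Fin.castLE hkn.le i)) * a ⟨k, hkn⟩ ^ s ≤ B) :
    M * (c * a ⟨k, hkn⟩ * r) ^ ((k : ℝ) + s) ≤
      4 ^ k * c ^ ((k : ℝ) + s) * B * r ^ ((k : ℝ) + s) := by
  set α := a ⟨k, hkn⟩ with hα
  have hα0 : 0 < α := ha _
  calc M * (c * α * r) ^ ((k : ℝ) + s)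
      ≤ (∏ i : Fin k, 4 * (a (Fin.castLE hkn.le i) / α)) * (c * α * r) ^ ((k : ℝ) + s) := by
        gcongr
    _ = 4 ^ k * c ^ ((k : ℝ) + s) * ((∏ i : Fin k, a (Fin.castLE hkn.le i)) * α ^ s) *
          r ^ ((k : ℝ) + s) := by
        rw [Real.mul_rpow (by positivity) hr.le, Real.mul_rpow hc.le hα0.le,
          Real.rpow_add hα0, Real.rpow_natCast, Finset.prod_mul_distrib, Finset.prod_div_distrib]
        simp only [Finset.prod_const, Finset.card_univ, Fintype.card_fin]
        field_simp
    _ ≤ _ := by gcongr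

theorem hausdorffMeasure_eq_zero_of_trace_lt [InnerProductSpace ℝ E] [FiniteDimensional ℝ E]
    [MeasurableSpace E] [BorelSpace E] {n k : ℕ} (hn : Module.finrank ℝ E = n) (hkn : k < n)
    {s δ : ℝ} (hs0 : 0 < s) (hs1 : s ≤ 1) (hδ : 0 < δ) {U K : Set E} (hU : IsOpen U) {f : E → E}
    (hf : ContDiffOn ℝ 1 f U) (hK : IsCompact K) (hKU : K ⊆ U) {φ : ℝ → E → E}
    (hφ0 : ∀ x ∈ K, φ 0 x = x) (hφK : ∀ x ∈ K, ∀ t, φ t x ∈ K)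
    (hφd : ∀ x ∈ K, ∀ t, HasDerivAt (fun s => φ s x) (f (φ t x)) t)
    (hφonto : ∀ t, φ t '' K = K) {X Y : E → ℝ}
    (hX : ∀ x ∈ K, ∀ w : Fin k → E, Orthonormal ℝ w →
      ∑ i, 2 * ⟪w i, fderiv ℝ f x (w i)⟫_ℝ ≤ X x)
    (hY : ∀ x ∈ K, ∀ w : Fin (k + 1) → E, Orthonormal ℝ w →
      ∑ i, 2 * ⟪w i, fderiv ℝ f x (w i)⟫_ℝ ≤ Y x)
    (hXY : ∀ x ∈ K, (1 - s) * X x + s * Y x ≤ -δ) :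
    μH[(k : ℝ) + s] K = 0 := by
  obtain ⟨L, hLip, hA⟩ := exists_lipschitzOnWith_and_norm_fderiv_le hU hf hK hKU
  obtain ⟨F, hF⟩ := hK.exists_bound_of_continuousOn (hf.continuousOn.mono hKU)
  have hn0 : (0 : ℝ) < n := by exact_mod_cast (Nat.zero_le k).trans_lt hkn
  set c : ℝ := 2 * √n with hc
  have hc0 : 0 < c := by positivity
  set κ : ℝ := 4 ^ k * c ^ ((k : ℝ) + s) with hκ
  have hκ0 : 0 < κ := by positivity
  set ζ : ℝ := 1 / (4 * κ) with hζ
  have hζ0 : 0 < ζ := by positivity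
  obtain ⟨T, hT0, hT⟩ : ∃ T > 0, Real.exp (-(δ * T) / 4) ≤ ζ := by
    have h1 : Tendsto (fun T : ℝ => Real.exp (-(δ * T) / 4)) atTop (𝓝 0) := by
      refine Real.tendsto_exp_atBot.comp ?_
      have : (fun T : ℝ => -(δ * T) / 4) = fun T => (-(δ / 4)) * T := by
        funext T
        ring
      rw [this]
      exact tendsto_id.const_mul_atTop_of_neg (by linarith)
    exact ((eventually_gt_atTop 0).and (h1.eventually (ge_mem_nhds hζ0))).exists
  obtain ⟨η, hη0, hη⟩ :=
    exists_pos_prod_add_mul_rpow_le hkn (Q := Real.exp (L * T)) hs0 hζ0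
  set D : ℝ := 2 * T * Real.exp (L * T) * Real.exp (L * T) with hD
  have hD0 : 0 < D := by positivity
  set θ : ℝ := η / D with hθ
  have hθ0 : 0 < θ := by positivity
  obtain ⟨ρ, hρ0, hlin⟩ := exists_uniform_linearization hU hf hK hKU hθ0
  obtain ⟨N, hN0, hFh, hLh, hδh⟩ : ∃ N : ℕ, 0 < N ∧ F * (T / N) < ρ / 2 ∧
      L * (L * (T / N)) < θ ∧ T / N * (n * (L : ℝ) ^ 2) < δ / 2 := by
    have hlim := tendsto_const_div_atTop_nhds_zero_nat T
    have h1 := hlim.const_mul F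
    have h2 := (hlim.const_mul (L : ℝ)).const_mul (L : ℝ)
    have h3 := hlim.mul_const (n * (L : ℝ) ^ 2)
    simp only [mul_zero, zero_mul] at h1 h2 h3
    exact ((eventually_gt_atTop 0).and ((h1.eventually (gt_mem_nhds (half_pos hρ0))).and
      ((h2.eventually (gt_mem_nhds hθ0)).and
        (h3.eventually (gt_mem_nhds (half_pos hδ)))))).exists
  set h : ℝ := T / N with hh
  have hh0 : 0 ≤ h := by positivity
  have hNh : N * h = T := by
    rw [hh]
    field_simp
  refine hausdorffMeasure_eq_zero_of_contracting_covers hK (hφonto T).ge (by positivity)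
    (ε₀ := ρ / 4 / Real.exp (L * T)) (by positivity) fun x hx r hr0 hr => ?_
  obtain ⟨b, σ, hσ, hσ0, hσL, hbσ, hvol⟩ := exists_singularValues_eulerProduct hn hkn hh0
    (A := fun j => fderiv ℝ f (φ (j * h) x)) (fun j => hA _ (hφK x hx _)) hs0.le hs1 hδh.le
    (fun j => hX _ (hφK x hx (j * h))) (fun j => hY _ (hφK x hx (j * h)))
    (fun j => hXY _ (hφK x hx (j * h))) N
  rw [hNh] at hσL hvol
  have ha0 : ∀ i, 0 < σ i + η := fun i => add_pos_of_nonneg_of_pos (hσ0 i) hη0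
  have hbox : ∀ z ∈ φ T '' (K ∩ closedBall x r), ∀ i,
      |⟪b i, z - φ T x⟫_ℝ| ≤ (σ i + η) * r := by
    rintro _ ⟨y, ⟨hyK, hyr⟩, rfl⟩ i
    have hyx : ‖φ 0 y - φ 0 x‖ ≤ r := by
      rw [hφ0 y hyK, hφ0 x hx, ← dist_eq_norm]
      exact hyr
    have hrρ : Real.exp (L * T) * ‖φ 0 y - φ 0 x‖ < ρ / 2 := by
      rw [le_div_iff₀ (Real.exp_pos _)] at hr
      have := mul_le_mul_of_nonneg_left hyx (Real.exp_pos (L * T)).le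
      linarith
    have herr := norm_sub_eulerProduct_le hLip hA hF (hφd x hx) (hφK x hx) (hφd y hyK)
      (hφK y hyK) hh0 hlin hθ0.le hFh hLh.le hrρ hNh
    set P := eulerProduct h (fun j => fderiv ℝ f (φ (j * h) x)) N
    have herr' : ‖φ T y - φ T x - P (φ 0 y - φ 0 x)‖ ≤ η * r := by
      refine herr.trans ?_
      have : 2 * θ * T * Real.exp (L * T) * Real.exp (L * T) = η := by
        rw [show 2 * θ * T * Real.exp (L * T) * Real.exp (L * T) = θ * D by rw [hD]; ring, hθ]
        field_simp
      rw [this]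
      gcongr
    have hsplit : ⟪b i, φ T y - φ T x⟫_ℝ = ⟪b i, P (φ 0 y - φ 0 x)⟫_ℝ +
        ⟪b i, φ T y - φ T x - P (φ 0 y - φ 0 x)⟫_ℝ := by
      rw [← inner_add_right, add_sub_cancel]
    rw [hsplit, add_mul]
    refine (abs_add_le _ _).trans (add_le_add ((hbσ i _).trans ?_) ?_)
    · exact mul_le_mul_of_nonneg_left hyx (hσ0 i)
    · refine (abs_real_inner_le_norm _ _).trans ?_
      rwa [b.norm_eq_one, one_mul]
  obtain ⟨G, hGS, hGcov, hGcard⟩ := exists_finset_cover_of_subset_box hkn b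
    (fun i j hij => add_le_add_left (hσ hij) η) ha0 hr0 hbox
  refine ⟨G, c * (σ ⟨k, hkn⟩ + η) * r, hGS.trans ?_, ?_, hGcov, ?_⟩
  · rintro _ ⟨y, hy, rfl⟩
    exact hφK y hy.1 T
  · exact mul_pos (mul_pos hc0 (ha0 _)) hr0
  · refine (card_mul_rpow_le hkn ha0 (B := 2 * ζ) hc0 hr0 hGcard ?_).trans (le_of_eq ?_)
    · have := hη σ hσ0 hσL
      linarith
    · rw [← hκ, hζ]
      field_simp
      norm_num

end HausdorffMeasure

section Eigenvalues

variable {E : Type*} [NormedAddCommGroup E] [InnerProductSpace ℝ E]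

theorem Antitone.eq_of_prod_X_sub_C_eq {n : ℕ} {a b : Fin n → ℝ} (ha : Antitone a)
    (hb : Antitone b) (h : ∏ i, (Polynomial.X - Polynomial.C (a i)) =
      ∏ i, (Polynomial.X - Polynomial.C (b i))) : a = b := by
  have hroots : ∀ c : Fin n → ℝ, (∏ i, (Polynomial.X - Polynomial.C (c i))).roots =
      (List.ofFn c : Multiset ℝ) := fun c => by
    rw [Polynomial.roots_prod _ _
      (by simp [Finset.prod_ne_zero_iff, Polynomial.X_sub_C_ne_zero])]
    simp [Fin.univ_val_map]
  have hperm := congrArg Polynomial.roots h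
  rw [hroots, hroots, Multiset.coe_eq_coe] at hperm
  exact List.ofFn_injective (hperm.eq_of_pairwise'
    (List.sortedGE_iff_pairwise.1 ha.sortedGE_ofFn)
    (List.sortedGE_iff_pairwise.1 hb.sortedGE_ofFn))

theorem LinearMap.IsSymmetric.inner_self_apply_eq_sum [FiniteDimensional ℝ E] {T : E →ₗ[ℝ] E}
    (hT : T.IsSymmetric) {n : ℕ} (hn : Module.finrank ℝ E = n) (v : E) :
    ⟪v, T v⟫_ℝ = ∑ i, hT.eigenvalues hn i * ⟪hT.eigenvectorBasis hn i, v⟫_ℝ ^ 2 := by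
  rw [← (hT.eigenvectorBasis hn).sum_inner_mul_inner v (T v)]
  refine Finset.sum_congr rfl fun i _ => ?_
  rw [← hT (hT.eigenvectorBasis hn i) v, hT.apply_eigenvectorBasis, real_inner_comm,
    real_inner_smul_left]
  simp only [RCLike.ofReal_real_eq_id, id_eq]
  ring

theorem exists_orthonormalBasis_of_charpoly_jacobian {n : ℕ}
    {f : EuclideanSpace ℝ (Fin n) → EuclideanSpace ℝ (Fin n)} {x : EuclideanSpace ℝ (Fin n)}
    {lam : Fin n → ℝ} (hlam : Antitone lam)
    (h : (jacobian f x + (jacobian f x)ᵀ).charpoly =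
      ∏ i : Fin n, (Polynomial.X - Polynomial.C (lam i))) :
    ∃ u : OrthonormalBasis (Fin n) ℝ (EuclideanSpace ℝ (Fin n)),
      ∀ v, 2 * ⟪v, fderiv ℝ f x v⟫_ℝ = ∑ i, lam i * ⟪u i, v⟫_ℝ ^ 2 := by
  set A := fderiv ℝ f x with hA
  let T : EuclideanSpace ℝ (Fin n) →ₗ[ℝ] EuclideanSpace ℝ (Fin n) :=
    (A + ContinuousLinearMap.adjoint A : EuclideanSpace ℝ (Fin n) →L[ℝ] _)
  have hTapp : ∀ v, T v = A v + ContinuousLinearMap.adjoint A v := fun _ => rfl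
  have hT : T.IsSymmetric := fun v w => by
    rw [hTapp, hTapp, inner_add_left, inner_add_right, ContinuousLinearMap.adjoint_inner_left,
      ContinuousLinearMap.adjoint_inner_right, add_comm]
  have hn : Module.finrank ℝ (EuclideanSpace ℝ (Fin n)) = n := finrank_euclideanSpace_fin
  have hmat : LinearMap.toMatrix (EuclideanSpace.basisFun (Fin n) ℝ).toBasis
      (EuclideanSpace.basisFun (Fin n) ℝ).toBasis T = jacobian f x + (jacobian f x)ᵀ := by
    ext i j
    rw [LinearMap.toMatrix_apply]
    have hadj : ContinuousLinearMap.adjoint A (EuclideanSpace.single j 1) i =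
        A (EuclideanSpace.single i 1) j := by
      have := ContinuousLinearMap.adjoint_inner_right A (EuclideanSpace.single i 1)
        (EuclideanSpace.single j 1)
      rw [EuclideanSpace.inner_single_left, EuclideanSpace.inner_single_right] at this
      simpa using this
    simp [hTapp, jacobian, hadj, ← hA]
  have heig : hT.eigenvalues hn = lam := by
    refine (hT.eigenvalues_antitone hn).eq_of_prod_X_sub_C_eq hlam ?_
    rw [← h, ← hmat, LinearMap.charpoly_toMatrix, hT.charpoly_eq hn]
    simp
  refine ⟨hT.eigenvectorBasis hn, fun v => ?_⟩
  rw [← heig, ← hT.inner_self_apply_eq_sum hn, hTapp, inner_add_right,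
    ContinuousLinearMap.adjoint_inner_right, real_inner_comm v (A v)]
  ring

theorem sum_castLE_le_sum_castLE_add {n p : ℕ} (hp : p ≤ n) {A B : E →L[ℝ] E}
    {lam μ : Fin n → ℝ} (hμ : Antitone μ) (u v : OrthonormalBasis (Fin n) ℝ E)
    (hu : ∀ z, 2 * ⟪z, A z⟫_ℝ = ∑ i, lam i * ⟪u i, z⟫_ℝ ^ 2)
    (hv : ∀ z, 2 * ⟪z, B z⟫_ℝ = ∑ i, μ i * ⟪v i, z⟫_ℝ ^ 2) :
    ∑ i : Fin p, lam (Fin.castLE hp i) ≤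
      ∑ i : Fin p, μ (Fin.castLE hp i) + 2 * p * ‖A - B‖ := by
  have hw : Orthonormal ℝ fun j : Fin p => u (Fin.castLE hp j) :=
    u.orthonormal.comp _ (Fin.castLE_injective hp)
  have heig : ∀ i, lam i = 2 * ⟪u i, A (u i)⟫_ℝ := fun i => by
    rw [hu, Finset.sum_eq_single i]
    · simp
    · intro j _ hj
      simp [u.inner_eq_zero hj]
    · simp
  have hle : ∀ i, lam i ≤ 2 * ⟪u i, B (u i)⟫_ℝ + 2 * ‖A - B‖ := fun i => by
    have h1 : ⟪u i, (A - B) (u i)⟫_ℝ ≤ ‖A - B‖ := by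
      refine (real_inner_le_norm _ _).trans ?_
      have := (A - B).le_opNorm (u i)
      rwa [u.norm_eq_one, mul_one, ← one_mul ‖(A - B) (u i)‖, ← u.norm_eq_one i] at this
    rw [_root_.sub_apply, inner_sub_right] at h1
    linarith [heig i]
  calc ∑ i : Fin p, lam (Fin.castLE hp i)
      ≤ ∑ i : Fin p, (2 * ⟪u (Fin.castLE hp i), B (u (Fin.castLE hp i))⟫_ℝ + 2 * ‖A - B‖) :=
        Finset.sum_le_sum fun i _ => hle _
    _ = ∑ i : Fin p, 2 * ⟪u (Fin.castLE hp i), B (u (Fin.castLE hp i))⟫_ℝ +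
          2 * p * ‖A - B‖ := by
        rw [Finset.sum_add_distrib]
        simp
        ring
    _ ≤ _ := by
        exact add_le_add_left (two_mul_sum_inner_le hp hμ v hv hw) _

theorem continuousOn_sum_castLE {X : Type*} [TopologicalSpace X] {U : Set X} {n p : ℕ}
    (hp : p ≤ n) {A : X → E →L[ℝ] E} (hA : ContinuousOn A U) {lam : X → Fin n → ℝ}
    (hlam : ∀ x ∈ U, Antitone (lam x))
    (hu : ∀ x ∈ U, ∃ u : OrthonormalBasis (Fin n) ℝ E,
      ∀ v, 2 * ⟪v, A x v⟫_ℝ = ∑ i, lam x i * ⟪u i, v⟫_ℝ ^ 2) :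
    ContinuousOn (fun x => ∑ i : Fin p, lam x (Fin.castLE hp i)) U := by
  intro x hx
  have hlim : Tendsto (fun y => 2 * p * ‖A y - A x‖) (𝓝[U] x) (𝓝 0) := by
    simpa using (tendsto_iff_norm_sub_tendsto_zero.1 (hA x hx)).const_mul (2 * (p : ℝ))
  refine tendsto_iff_dist_tendsto_zero.2 (squeeze_zero' (Eventually.of_forall fun _ => dist_nonneg)
    ?_ hlim)
  filter_upwards [self_mem_nhdsWithin] with y hy
  obtain ⟨u, hux⟩ := hu x hx
  obtain ⟨v, hvy⟩ := hu y hy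
  have h1 := sum_castLE_le_sum_castLE_add hp (hlam x hx) v u hvy hux
  have h2 := sum_castLE_le_sum_castLE_add hp (hlam y hy) u v hux hvy
  rw [norm_sub_rev] at h2
  rw [Real.dist_eq, abs_le]
  constructor <;> linarith

theorem IsCompact.exists_lt_forall_le_neg {X : Type*} [TopologicalSpace X] {K : Set X}
    (hK : IsCompact K) {a b : X → ℝ} (ha : ContinuousOn a K) (hb : ContinuousOn b K) {s : ℝ}
    (hs : 0 < s) (h : ∀ x ∈ K, (1 - s) * a x + s * b x < 0) :
    ∃ s' δ, 0 < s' ∧ s' < s ∧ 0 < δ ∧ ∀ x ∈ K, (1 - s') * a x + s' * b x ≤ -δ := by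
  rcases K.eq_empty_or_nonempty with rfl | hne
  · exact ⟨s / 2, 1, by linarith, by linarith, one_pos, by simp⟩
  obtain ⟨x₀, hx₀, hmax⟩ := hK.exists_isMaxOn hne
    ((continuousOn_const.mul ha).add (continuousOn_const.mul hb) :
      ContinuousOn (fun x => (1 - s) * a x + s * b x) K)
  obtain ⟨B, hB⟩ := hK.exists_bound_of_continuousOn (ha.sub hb)
  have hB0 : 0 ≤ B := (norm_nonneg _).trans (hB x₀ hx₀)
  obtain ⟨δ, hδ⟩ : ∃ δ, δ = -((1 - s) * a x₀ + s * b x₀) := ⟨_, rfl⟩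
  have hδ0 : 0 < δ := by linarith [h x₀ hx₀]
  set τ := min (s / 2) (δ / (2 * (B + 1))) with hτ
  have hτ0 : 0 < τ := lt_min (by linarith) (by positivity)
  have hτs : τ ≤ s / 2 := min_le_left _ _
  have hτB : τ * (B + 1) ≤ δ / 2 := by
    have : τ ≤ δ / (2 * (B + 1)) := min_le_right _ _
    rw [le_div_iff₀ (by positivity)] at this
    linarith
  refine ⟨s - τ, δ / 2, by linarith, by linarith, by linarith, fun x hx => ?_⟩
  have h1 : (1 - s) * a x + s * b x ≤ -δ := by
    have := hmax hx
    change (1 - s) * a x + s * b x ≤ (1 - s) * a x₀ + s * b x₀ at this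
    linarith
  have h2 : τ * (a x - b x) ≤ τ * (B + 1) := by
    have := (le_abs_self _).trans (hB x hx)
    gcongr
    simp only [Pi.sub_apply] at this
    linarith
  linarith

theorem dimH_lt_of_sum_lt [FiniteDimensional ℝ E] {n k : ℕ} (hn : Module.finrank ℝ E = n)
    (hkn : k < n) {s : ℝ} (hs0 : 0 < s) (hs1 : s ≤ 1) {U K : Set E} (hU : IsOpen U) {f : E → E}
    (hf : ContDiffOn ℝ 1 f U) (hK : IsCompact K) (hKU : K ⊆ U) {φ : ℝ → E → E}
    (hφ0 : ∀ x ∈ K, φ 0 x = x) (hφK : ∀ x ∈ K, ∀ t, φ t x ∈ K)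
    (hφd : ∀ x ∈ K, ∀ t, HasDerivAt (fun s => φ s x) (f (φ t x)) t)
    (hφonto : ∀ t, φ t '' K = K) {lam : E → Fin n → ℝ} (hlam : ∀ x ∈ U, Antitone (lam x))
    (hu : ∀ x ∈ U, ∃ u : OrthonormalBasis (Fin n) ℝ E,
      ∀ v, 2 * ⟪v, fderiv ℝ f x v⟫_ℝ = ∑ i, lam x i * ⟪u i, v⟫_ℝ ^ 2)
    (hcond : ∀ x ∈ U,
      (∑ i : Fin k, lam x (Fin.castLE hkn.le i)) + s * lam x ⟨k, hkn⟩ < 0) :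
    dimH K < (k : ENNReal) + ENNReal.ofReal s := by
  have hA : ContinuousOn (fderiv ℝ f) U := hf.continuousOn_fderiv_of_isOpen hU le_rfl
  have hsucc : ∀ x, ∑ i : Fin (k + 1), lam x (Fin.castLE hkn i) =
      ∑ i : Fin k, lam x (Fin.castLE hkn.le i) + lam x ⟨k, hkn⟩ := fun x => by
    rw [Fin.sum_univ_castSucc]
    rfl
  obtain ⟨s', δ, hs'0, hs's, hδ, hle⟩ := hK.exists_lt_forall_le_neg
    ((continuousOn_sum_castLE hkn.le hA hlam hu).mono hKU)
    ((continuousOn_sum_castLE hkn hA hlam hu).mono hKU) hs0 fun x hx => by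
      rw [hsucc]
      linarith [hcond x (hKU hx)]
  borelize E
  have hbound : ∀ p (hp : p ≤ n), ∀ x ∈ K, ∀ w : Fin p → E, Orthonormal ℝ w →
      ∑ i, 2 * ⟪w i, fderiv ℝ f x (w i)⟫_ℝ ≤ ∑ i : Fin p, lam x (Fin.castLE hp i) :=
    fun p hp x hx w hw => by
      obtain ⟨u, hux⟩ := hu x (hKU hx)
      exact two_mul_sum_inner_le hp (hlam x (hKU hx)) u hux hw
  have hzero := hausdorffMeasure_eq_zero_of_trace_lt hn hkn hs'0 (hs's.le.trans hs1) hδ hU hf hK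
    hKU hφ0 hφK hφd hφonto (hbound k hkn.le) (hbound (k + 1) hkn) hle
  have hdim : dimH K ≤ ((k + s'.toNNReal : NNReal) : ENNReal) := by
    refine dimH_le_of_hausdorffMeasure_ne_top ?_
    rw [NNReal.coe_add, NNReal.coe_natCast, Real.coe_toNNReal _ hs'0.le, hzero]
    exact ENNReal.zero_ne_top
  refine hdim.trans_lt ?_
  rw [ENNReal.coe_add, ENNReal.coe_natCast]
  exact ENNReal.add_lt_add_left (ENNReal.natCast_ne_top k)
    ((ENNReal.ofReal_lt_ofReal_iff hs0).2 hs's)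

end Eigenvalues

/-- Douady–Oesterlé / Ilyashenko: let `f` be `C¹` on an open set `U` and, for
`x ∈ U`, let `lam x 0 ≥ lam x 1 ≥ … ≥ lam x (n-1)` be the eigenvalues (with multiplicity,
in decreasing order, i.e. the roots of the characteristic polynomial) of the symmetric matrix
`Df(x) + Df(x)ᵀ`.  If `K ⊆ U` is a compact set invariant under the flow of `f` and
`λ₁(x) + ⋯ + λ_k(x) + s·λ_{k+1}(x) < 0` on `U` for some `1 ≤ k < n`, `s ∈ [0,1]`, then
`dim_H K < k + s`. -/
theorem hausdorff_dimension_lt_of_eigenvalue_condition {n : ℕ}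
    (U : Set (EuclideanSpace ℝ (Fin n))) (hU : IsOpen U)
    (f : EuclideanSpace ℝ (Fin n) → EuclideanSpace ℝ (Fin n))
    (hf : ContDiffOn ℝ 1 f U)
    (lam : EuclideanSpace ℝ (Fin n) → Fin n → ℝ)
    (hlam_eig : ∀ x ∈ U,
      (jacobian f x + (jacobian f x)ᵀ).charpoly =
        ∏ i : Fin n, (Polynomial.X - Polynomial.C (lam x i)))
    (hlam_dec : ∀ x ∈ U, Antitone (lam x))
    (K : Set (EuclideanSpace ℝ (Fin n))) (hK : IsCompact K) (hKU : K ⊆ U)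
    (φ : ℝ → EuclideanSpace ℝ (Fin n) → EuclideanSpace ℝ (Fin n))
    (hφ0 : ∀ x ∈ K, φ 0 x = x)
    (hφK : ∀ x ∈ K, ∀ t : ℝ, φ t x ∈ K)
    (hφd : ∀ x ∈ K, ∀ t : ℝ, HasDerivAt (fun s => φ s x) (f (φ t x)) t)
    (hφonto : ∀ t : ℝ, φ t '' K = K)
    (k : ℕ) (hk1 : 1 ≤ k) (hkn : k < n) (s : ℝ) (hs : s ∈ Set.Icc (0 : ℝ) 1)
    (hcond : ∀ x ∈ U,
      (∑ i : Fin k, lam x (Fin.castLE hkn.le i)) + s * lam x ⟨k, hkn⟩ < 0) :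
    dimH K < (k : ENNReal) + ENNReal.ofReal s := by
  have hfin : Module.finrank ℝ (EuclideanSpace ℝ (Fin n)) = n := finrank_euclideanSpace_fin
  have hspec : ∀ x ∈ U, ∃ u : OrthonormalBasis (Fin n) ℝ (EuclideanSpace ℝ (Fin n)),
      ∀ v, 2 * ⟪v, fderiv ℝ f x v⟫_ℝ = ∑ i, lam x i * ⟪u i, v⟫_ℝ ^ 2 := fun x hx =>
    exists_orthonormalBasis_of_charpoly_jacobian (hlam_dec x hx) (hlam_eig x hx)
  rcases hs.1.eq_or_lt with rfl | hs0
  · obtain ⟨m, rfl⟩ := Nat.exists_eq_add_of_le' hk1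
    have hlt := dimH_lt_of_sum_lt hfin (k := m) (by omega) one_pos le_rfl hU hf hK hKU hφ0 hφK
      hφd hφonto hlam_dec hspec fun x hx => by
        have h := hcond x hx
        rw [zero_mul, add_zero, Fin.sum_univ_castSucc] at h
        rw [one_mul]
        exact h
    simpa using hlt
  · exact dimH_lt_of_sum_lt hfin hkn hs0 hs.2 hU hf hK hKU hφ0 hφK hφd hφonto hlam_dec hspec hcond
end
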